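/- Let Q=(0,1)² and fix a constant M>2. For every n ∈ ℕ with n ≥ 1, the set A_n := {f ∈ X : there exists E ⊆ Q, a finite union of pairwise disjoint open triangles, with |E| < 1/n and |f(E)| > 1 − 1/n} is dense in the metric space (X,d). -/

import Mathlib

open MeasureTheory Set
open scoped ENNReal

noncomputable section

abbrev Plane := EuclideanSpace ℝ (Fin 2)

/-- The open unit square `(0,1)²`. -/
def unitSq : Set Plane := {x | 0 < x 0 ∧ x 0 < 1 ∧ 0 < x 1 ∧ x 1 < 1}

/-- Standard basis vectors of the plane. -/
def e2 (i : Fin 2) : Plane := EuclideanSpace.single i 1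

/-- The set of approximating values in the definition of the variation of `f` on `U`:
integrals against `C¹_c` test fields `φ = (φ₁, φ₂)` all of whose four components are
bounded by `1` in absolute value. -/
def varSet (f : Plane → Plane) (U : Set Plane) : Set ℝ :=
  {v | ∃ φ : Plane → Plane × Plane,
    ContDiff ℝ 1 φ ∧ HasCompactSupport φ ∧ tsupport φ ⊆ U ∧
    (∀ x i, |(φ x).1 i| ≤ 1 ∧ |(φ x).2 i| ≤ 1) ∧
    v = ∫ x in U, ((f x 0) * (fderiv ℝ (fun y => (φ y).1 0) x (e2 0)
                    + fderiv ℝ (fun y => (φ y).1 1) x (e2 1))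
        + (f x 1) * (fderiv ℝ (fun y => (φ y).2 0) x (e2 0)
                    + fderiv ℝ (fun y => (φ y).2 1) x (e2 1)))}

/-- The variation of `f` in `U`. -/
def Var (f : Plane → Plane) (U : Set Plane) : ℝ := sSup (varSet f U)

/-- `f` is a `BV` map on `U`. -/
def IsBV (f : Plane → Plane) (U : Set Plane) : Prop :=
  IntegrableOn f U volume ∧ BddAbove (varSet f U)

/-- `f` is a homeomorphism of `U` onto `V`, with inverse `g`. -/
def IsHomeoOn (f g : Plane → Plane) (U V : Set Plane) : Prop :=
  BijOn f U V ∧ ContinuousOn f U ∧ InvOn g f U V ∧ ContinuousOn g V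

/-- `f` (as a total function, representing its own continuous extension) extends
continuously to the closure of the unit square, with `f = Id` on the boundary. -/
def ExtendsToId (f : Plane → Plane) : Prop :=
  ContinuousOn f (closure unitSq) ∧ EqOn f id (frontier unitSq)

/-- The space `X` of `BV` homeomorphisms of the unit square fixing the boundary with
variation smaller than `M`; an element is a pair (homeomorphism, inverse). -/
def X (M : ℝ) : Set ((Plane → Plane) × (Plane → Plane)) :=
  {p | IsHomeoOn p.1 p.2 unitSq unitSq ∧ ExtendsToId p.1 ∧
    IsBV p.1 unitSq ∧ Var p.1 unitSq < M}

/-- Sup distance `‖f - g‖_∞` over the set `U`. -/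
def supDist (f g : Plane → Plane) (U : Set Plane) : ℝ := ⨆ x : U, dist (f x) (g x)

/-- The distance `d` on `X`. -/
def dX (M : ℝ) (p q : (Plane → Plane) × (Plane → Plane)) : ℝ :=
  supDist p.1 q.1 unitSq + supDist p.2 q.2 unitSq +
    |1 / (M - Var p.1 unitSq) - 1 / (M - Var q.1 unitSq)|

/-- `A` is open in the metric space `(X, d)`. -/
def OpenInX (M : ℝ) (A : Set ((Plane → Plane) × (Plane → Plane))) : Prop :=
  A ⊆ X M ∧ ∀ p ∈ A, ∃ ε > 0, ∀ q ∈ X M, dX M p q < ε → q ∈ A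

/-- `A` is dense in the metric space `(X, d)`. -/
def DenseInX (M : ℝ) (A : Set ((Plane → Plane) × (Plane → Plane))) : Prop :=
  A ⊆ X M ∧ ∀ p ∈ X M, ∀ ε > 0, ∃ q ∈ A, dX M p q < ε

/-- An open triangle in the plane. -/
def IsOpenTriangle (T : Set Plane) : Prop :=
  ∃ a b c : Plane, T = interior (convexHull ℝ {a, b, c})

/-- A finite union of pairwise disjoint open triangles. -/
def FinUnionTriangles (E : Set Plane) : Prop :=
  ∃ (k : ℕ) (T : Fin k → Set Plane), (∀ i, IsOpenTriangle (T i)) ∧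
    (∀ i j, i ≠ j → Disjoint (T i) (T j)) ∧ E = ⋃ i, T i

/-- The set `A` of homeomorphisms mapping a null set onto a set of full measure. -/
def Afull (M : ℝ) : Set ((Plane → Plane) × (Plane → Plane)) :=
  {p ∈ X M | ∃ E ⊆ unitSq, volume E = 0 ∧ volume (p.1 '' E) = 1}

/-- The set `A_n`. -/
def An (M : ℝ) (n : ℕ) : Set ((Plane → Plane) × (Plane → Plane)) :=
  {p ∈ X M | ∃ E ⊆ unitSq, FinUnionTriangles E ∧
    volume E < 1 / (n : ℝ≥0∞) ∧ 1 - 1 / (n : ℝ≥0∞) < volume (p.1 '' E)}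

open Filter Topology

/-- A pointwise comparison of increments gives a comparison of variations. -/
theorem eVariationOn_mono_of_edist {f g : ℝ → ℝ} {s : Set ℝ}
    (h : ∀ x ∈ s, ∀ y ∈ s, x ≤ y → edist (f x) (f y) ≤ edist (g x) (g y)) :
    eVariationOn f s ≤ eVariationOn g s := by
  refine iSup_le fun p => ?_
  refine le_trans (Finset.sum_le_sum fun i _ => ?_)
    (eVariationOn.sum_le (f := g) (s := s) (n := p.1) p.2.2.1 p.2.2.2)
  rw [edist_comm (f _), edist_comm (g _)]
  exact h _ (p.2.2.2 i) _ (p.2.2.2 (i + 1)) (p.2.2.1 (Nat.le_succ i))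

theorem eVariationOn_le_of_lipschitz {f : ℝ → ℝ} {a b K : ℝ} (hab : a ≤ b) (hK : 0 ≤ K)
    (h : ∀ x ∈ Icc a b, ∀ y ∈ Icc a b, |f x - f y| ≤ K * |x - y|) :
    eVariationOn f (Icc a b) ≤ ENNReal.ofReal (K * (b - a)) := by
  have h1 : eVariationOn f (Icc a b) ≤ eVariationOn (fun x => K * x) (Icc a b) := by
    refine eVariationOn_mono_of_edist fun x hx y hy _ => ?_
    rw [edist_dist, edist_dist]
    refine ENNReal.ofReal_le_ofReal ?_
    rw [Real.dist_eq, Real.dist_eq, ← mul_sub, abs_mul, abs_of_nonneg hK]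
    exact h x hx y hy
  refine h1.trans ?_
  have hm : MonotoneOn (fun x => K * x) (Icc a b) := fun x _ y _ hxy =>
    mul_le_mul_of_nonneg_left hxy hK
  have := hm.eVariationOn_eq (left_mem_Icc.2 hab) (right_mem_Icc.2 hab)
  rw [inter_self] at this
  rw [this, mul_sub]

theorem eVariationOn_add_le (f g : ℝ → ℝ) (s : Set ℝ) :
    eVariationOn (fun x => f x + g x) s ≤ eVariationOn f s + eVariationOn g s := by
  refine iSup_le fun p => ?_
  refine le_trans ?_ (add_le_add
    (eVariationOn.sum_le (f := f) (s := s) (n := p.1) p.2.2.1 p.2.2.2)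
    (eVariationOn.sum_le (f := g) (s := s) (n := p.1) p.2.2.1 p.2.2.2))
  rw [← Finset.sum_add_distrib]
  exact Finset.sum_le_sum fun i _ => edist_add_add_le _ _ _ _

/-- The variation of a `C¹` function is at most the integral of the absolute derivative. -/
theorem eVariationOn_le_lintegral_deriv {f f' : ℝ → ℝ} {a b : ℝ} (hab : a ≤ b)
    (hf : ∀ x, HasDerivAt f (f' x) x) (hc : Continuous f') :
    eVariationOn f (Icc a b) ≤ ∫⁻ t in Icc a b, ENNReal.ofReal |f' t| := by
  set P : ℝ → ℝ := fun x => ∫ t in a..x, |f' t| with hP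
  have hint : ∀ x y : ℝ, IntervalIntegrable (fun t => |f' t|) volume x y :=
    fun x y => hc.abs.intervalIntegrable x y
  have hPsub : ∀ x y, P y - P x = ∫ t in x..y, |f' t| := fun x y => by
    rw [hP]; exact intervalIntegral.integral_interval_sub_left (hint _ _) (hint _ _)
  have hPm : Monotone P := fun x y hxy => by
    have := hPsub x y
    have h2 : 0 ≤ ∫ t in x..y, |f' t| :=
      intervalIntegral.integral_nonneg hxy fun t _ => abs_nonneg _
    linarith
  have h1 : eVariationOn f (Icc a b) ≤ eVariationOn P (Icc a b) := by
    refine eVariationOn_mono_of_edist fun x hx y hy hxy => ?_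
    rw [edist_comm (f x), edist_comm (P x), edist_dist, edist_dist, Real.dist_eq, Real.dist_eq,
      hPsub, ← intervalIntegral.integral_eq_sub_of_hasDerivAt (fun t _ => hf t)
        (hc.intervalIntegrable x y)]
    refine ENNReal.ofReal_le_ofReal ?_
    refine le_trans ?_ (le_abs_self _)
    exact intervalIntegral.abs_integral_le_integral_abs hxy
  have h2 := (hPm.monotoneOn (Icc a b)).eVariationOn_eq (left_mem_Icc.2 hab)
    (right_mem_Icc.2 hab)
  rw [inter_self] at h2
  refine (h1.trans h2.le).trans ?_
  rw [hPsub, intervalIntegral.integral_of_le hab, ← integral_Icc_eq_integral_Ioc,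
    ofReal_integral_eq_lintegral_ofReal]
  · exact hc.abs.continuousOn.integrableOn_Icc
  · exact Eventually.of_forall fun t => abs_nonneg _

/-- Integrating a function against the derivative of a test function bounded by one is
controlled by its variation. -/
theorem integral_mul_deriv_le_eVariationOn {u ψ ψ' : ℝ → ℝ} (hu : Continuous u)
    (hψ : ∀ t, HasDerivAt ψ (ψ' t) t) (hψ' : Continuous ψ') (h0 : ψ 0 = 0) (h1 : ψ 1 = 0)
    (hb : ∀ t, |ψ t| ≤ 1) :
    ENNReal.ofReal (∫ t in (0 : ℝ)..1, u t * ψ' t) ≤ eVariationOn u (Icc 0 1) := by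
  by_cases hV : eVariationOn u (Icc 0 1) = ∞
  · simp [hV]
  refine ENNReal.ofReal_le_of_le_toReal ?_
  set V := (eVariationOn u (Icc 0 1)).toReal with hVdef
  obtain ⟨C, hC⟩ := isCompact_Icc.exists_bound_of_continuousOn (s := Icc (0 : ℝ) 1)
    hψ'.continuousOn
  have hC0 : 0 ≤ C := le_trans (norm_nonneg _) (hC 0 (by simp))
  refine le_of_forall_pos_le_add fun ε hε => ?_
  have huc : UniformContinuousOn u (Icc 0 1) :=
    isCompact_Icc.uniformContinuousOn_of_continuous hu.continuousOn
  rw [Metric.uniformContinuousOn_iff] at huc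
  obtain ⟨d, hd, hud⟩ := huc (ε / (C + 1)) (by positivity)
  obtain ⟨n, hn⟩ := exists_nat_one_div_lt hd
  set x : ℕ → ℝ := fun k => min 1 ((k : ℝ) / (n + 1)) with hx
  have hnp : (0 : ℝ) < n + 1 := by positivity
  have hxm : Monotone x := fun i j hij => by
    refine min_le_min le_rfl ?_
    gcongr
  have hx0 : x 0 = 0 := by simp [hx]
  have hx1 : x (n + 1) = 1 := by
    simp only [hx]; push_cast; rw [div_self hnp.ne']; simp
  have hxI : ∀ k, x k ∈ Icc (0 : ℝ) 1 := fun k => ⟨by simp only [hx]; positivity, min_le_left _ _⟩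
  have hxd : ∀ k, x (k + 1) - x k ≤ 1 / (n + 1) := fun k => by
    simp only [hx]
    have : ((k + 1 : ℕ) : ℝ) / (n + 1) = (k : ℝ) / (n + 1) + 1 / (n + 1) := by
      push_cast; ring
    rw [this]
    have h3 : (0 : ℝ) < 1 / (n + 1) := by positivity
    rcases le_total 1 ((k : ℝ) / (n + 1)) with h | h
    · rw [min_eq_left h, min_eq_left (by linarith)]; linarith
    · rw [min_eq_right h]; have := min_le_right 1 ((k : ℝ) / (n + 1) + 1 / (n + 1)); linarith
  have hII : ∀ a b, IntervalIntegrable (fun t => u t * ψ' t) volume a b :=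
    fun a b => (hu.mul hψ').intervalIntegrable a b
  have hsplit : ∫ t in (0 : ℝ)..1, u t * ψ' t
      = ∑ k ∈ Finset.range (n + 1), ∫ t in (x k)..(x (k + 1)), u t * ψ' t := by
    rw [intervalIntegral.sum_integral_adjacent_intervals fun k _ => hII _ _, hx0, hx1]
  have hpiece : ∀ k, ∫ t in (x k)..(x (k + 1)), u t * ψ' t
      ≤ u (x k) * (ψ (x (k + 1)) - ψ (x k)) + ε * (x (k + 1) - x k) := by
    intro k
    have hle := hxm (Nat.le_succ k)
    have e1 : ∫ t in (x k)..(x (k + 1)), u (x k) * ψ' t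
        = u (x k) * (ψ (x (k + 1)) - ψ (x k)) := by
      rw [intervalIntegral.integral_const_mul,
        intervalIntegral.integral_eq_sub_of_hasDerivAt (fun t _ => hψ t)
          (hψ'.intervalIntegrable _ _)]
    have e2 : ∫ t in (x k)..(x (k + 1)), ε = ε * (x (k + 1) - x k) := by
      rw [intervalIntegral.integral_const, smul_eq_mul, mul_comm]
    have c1 : Continuous fun t => u (x k) * ψ' t := continuous_const.mul hψ'
    have c2 : Continuous fun _ : ℝ => ε := continuous_const
    rw [← e1, ← e2, ← intervalIntegral.integral_add (c1.intervalIntegrable _ _)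
      (c2.intervalIntegrable _ _)]
    refine intervalIntegral.integral_mono_on hle (hII _ _)
      ((c1.add c2).intervalIntegrable _ _) fun t ht => ?_
    have htI : t ∈ Icc (0 : ℝ) 1 := ⟨(hxI k).1.trans ht.1, ht.2.trans (hxI (k + 1)).2⟩
    have hdist : dist t (x k) < d := by
      rw [Real.dist_eq, abs_of_nonneg (by linarith [ht.1])]
      have := hxd k
      have := ht.2
      simp only [Nat.succ_eq_add_one] at *
      linarith
    have h5 := hud t htI (x k) (hxI k) hdist
    rw [Real.dist_eq] at h5
    have h6 := hC t htI
    rw [Real.norm_eq_abs] at h6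
    have h7 : (u t - u (x k)) * ψ' t ≤ ε := by
      calc (u t - u (x k)) * ψ' t ≤ |u t - u (x k)| * |ψ' t| := by
            rw [← abs_mul]; exact le_abs_self _
        _ ≤ ε / (C + 1) * C := mul_le_mul h5.le h6 (abs_nonneg _) (by positivity)
        _ ≤ ε := by
            rw [div_mul_eq_mul_div, div_le_iff₀ (by positivity)]
            nlinarith
    linarith [h7, sub_mul (u t) (u (x k)) (ψ' t)]
  have habel : ∀ m : ℕ, ∑ k ∈ Finset.range m, u (x k) * (ψ (x (k + 1)) - ψ (x k))
      = u (x m) * ψ (x m) - u (x 0) * ψ (x 0)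
        - ∑ k ∈ Finset.range m, ψ (x (k + 1)) * (u (x (k + 1)) - u (x k)) := by
    intro m
    induction m with
    | zero => simp
    | succ m ih => rw [Finset.sum_range_succ, Finset.sum_range_succ, ih]; ring
  have hvar : ∑ k ∈ Finset.range (n + 1), |u (x (k + 1)) - u (x k)| ≤ V := by
    have h8 := eVariationOn.sum_le (f := u) (s := Icc 0 1) (n := n + 1) hxm hxI
    have h9 := (ENNReal.toReal_le_toReal (ne_top_of_le_ne_top hV h8) hV).2 h8
    refine le_trans (le_of_eq ?_) h9
    rw [ENNReal.toReal_sum fun _ _ => edist_ne_top _ _]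
    refine Finset.sum_congr rfl fun k _ => ?_
    rw [edist_dist, ENNReal.toReal_ofReal dist_nonneg, Real.dist_eq]
  have htel : ∑ k ∈ Finset.range (n + 1), ε * (x (k + 1) - x k) = ε := by
    rw [← Finset.mul_sum, Finset.sum_range_sub, hx1, hx0]; ring
  rw [hsplit]
  refine (Finset.sum_le_sum fun k _ => hpiece k).trans ?_
  rw [Finset.sum_add_distrib, htel, habel, hx1, hx0, h0, h1]
  have h10 : -∑ k ∈ Finset.range (n + 1), ψ (x (k + 1)) * (u (x (k + 1)) - u (x k)) ≤ V := by
    rw [← Finset.sum_neg_distrib]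
    refine (Finset.sum_le_sum fun k _ => ?_).trans hvar
    calc -(ψ (x (k + 1)) * (u (x (k + 1)) - u (x k)))
        ≤ |ψ (x (k + 1)) * (u (x (k + 1)) - u (x k))| := neg_le_abs _
      _ = |ψ (x (k + 1))| * |u (x (k + 1)) - u (x k)| := abs_mul _ _
      _ ≤ 1 * |u (x (k + 1)) - u (x k)| :=
          mul_le_mul_of_nonneg_right (hb _) (abs_nonneg _)
      _ = _ := one_mul _
  linarith

/-- The point of the line in direction `j` at height `s` with parameter `t`. -/
def linePt (j : Fin 2) (s t : ℝ) : Plane := if j = 0 then !₂[t, s] else !₂[s, t]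

theorem linePt_one_zero (s t : ℝ) : linePt 1 s t 0 = s := by simp [linePt]
theorem linePt_one_one (s t : ℝ) : linePt 1 s t 1 = t := by simp [linePt]

theorem plane_ext {x y : Plane} (h0 : x 0 = y 0) (h1 : x 1 = y 1) : x = y := by
  ext i; fin_cases i <;> assumption

theorem continuous_linePt (j : Fin 2) : Continuous fun p : ℝ × ℝ => linePt j p.1 p.2 := by
  fin_cases j
  · refine (PiLp.continuous_toLp 2 _).comp (continuous_pi fun i => ?_)
    fin_cases i
    · exact continuous_snd
    · exact continuous_fst
  · refine (PiLp.continuous_toLp 2 _).comp (continuous_pi fun i => ?_)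
    fin_cases i
    · exact continuous_fst
    · exact continuous_snd

theorem measurableEmbedding_linePt (j : Fin 2) :
    MeasurableEmbedding fun p : ℝ × ℝ => linePt j p.1 p.2 := by
  refine (continuous_linePt j).measurableEmbedding fun p q h => ?_
  have h0 := congrArg (fun x : Plane => x 0) h
  have h1 := congrArg (fun x : Plane => x 1) h
  fin_cases j
  · simp [linePt] at h0 h1; exact Prod.ext h1 h0
  · simp [linePt] at h0 h1; exact Prod.ext h0 h1

theorem measurePreserving_linePt (j : Fin 2) :
    MeasurePreserving (fun p : ℝ × ℝ => linePt j p.1 p.2) volume volume := by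
  have h1 : MeasurePreserving (fun p : ℝ × ℝ => linePt 1 p.1 p.2) volume volume :=
    (PiLp.volume_preserving_toLp (Fin 2)).comp (volume_preserving_finTwoArrow ℝ).symm
  fin_cases j
  · have h2 : MeasurePreserving (Prod.swap : ℝ × ℝ → ℝ × ℝ) volume volume :=
      Measure.measurePreserving_swap
    exact h1.comp h2
  · exact h1

theorem linePt_mem_unitSq {j : Fin 2} {s t : ℝ} :
    linePt j s t ∈ unitSq ↔ s ∈ Ioo (0 : ℝ) 1 ∧ t ∈ Ioo (0 : ℝ) 1 := by
  fin_cases j <;> simp [linePt, unitSq] <;> tauto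

theorem preimage_linePt_unitSq (j : Fin 2) :
    (fun p : ℝ × ℝ => linePt j p.1 p.2) ⁻¹' unitSq = Ioo (0 : ℝ) 1 ×ˢ Ioo (0 : ℝ) 1 := by
  ext ⟨s, t⟩; exact linePt_mem_unitSq

theorem continuous_coord (i : Fin 2) : Continuous fun x : Plane => x i :=
  (EuclideanSpace.proj i : Plane →L[ℝ] ℝ).continuous

theorem isOpen_unitSq : IsOpen unitSq := by
  have : unitSq = (fun x : Plane => x 0) ⁻¹' Ioo 0 1 ∩ (fun x : Plane => x 1) ⁻¹' Ioo 0 1 := by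
    ext x; simp [unitSq, and_assoc]
  rw [this]
  exact (isOpen_Ioo.preimage (continuous_coord 0)).inter (isOpen_Ioo.preimage (continuous_coord 1))

theorem volume_rect (a b c d : ℝ) :
    volume {x : Plane | a < x 0 ∧ x 0 < b ∧ c < x 1 ∧ x 1 < d}
      = ENNReal.ofReal (b - a) * ENNReal.ofReal (d - c) := by
  rw [← (measurePreserving_linePt 1).measure_preimage_emb (measurableEmbedding_linePt 1)]
  have : (fun p : ℝ × ℝ => linePt 1 p.1 p.2) ⁻¹'
      {x : Plane | a < x 0 ∧ x 0 < b ∧ c < x 1 ∧ x 1 < d} = Ioo a b ×ˢ Ioo c d := by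
    ext ⟨s, t⟩; simp [linePt, and_assoc]
  rw [this, Measure.volume_eq_prod, Measure.prod_prod, Real.volume_Ioo, Real.volume_Ioo]

theorem volume_unitSq : volume unitSq = 1 := by
  have := volume_rect 0 1 0 1
  simpa [unitSq] using this

/-- Scalar test functions on the unit square. -/
def IsTest (ψ : Plane → ℝ) : Prop :=
  ContDiff ℝ 1 ψ ∧ HasCompactSupport ψ ∧ tsupport ψ ⊆ unitSq ∧ ∀ x, |ψ x| ≤ 1

/-- The pairing of a scalar function with the `j`-th derivative of a test function. -/
def pairing (u ψ : Plane → ℝ) (j : Fin 2) : ℝ :=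
  ∫ x in unitSq, u x * fderiv ℝ ψ x (e2 j)

theorem IsTest.continuous_deriv {ψ : Plane → ℝ} (h : IsTest ψ) (j : Fin 2) :
    Continuous fun x => fderiv ℝ ψ x (e2 j) :=
  (h.1.continuous_fderiv one_ne_zero).clm_apply continuous_const

theorem IsTest.integrable {ψ u : Plane → ℝ} (h : IsTest ψ) (hu : Continuous u) (j : Fin 2) :
    Integrable fun x => u x * fderiv ℝ ψ x (e2 j) := by
  refine (hu.mul (h.continuous_deriv j)).integrable_of_hasCompactSupport ?_
  exact (h.2.1.fderiv_apply (𝕜 := ℝ) (e2 j)).mul_left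

theorem hasDerivAt_linePt (j : Fin 2) (s t : ℝ) :
    HasDerivAt (fun t => linePt j s t) (e2 j) t := by
  have : (fun t => linePt j s t) = fun t => linePt j s 0 + t • e2 j := by
    funext t
    fin_cases j <;> refine plane_ext ?_ ?_ <;> simp [linePt, e2]
  rw [this]
  simpa using ((hasDerivAt_id t).smul_const (e2 j)).const_add (linePt j s 0)

theorem continuous_linePt_right (j : Fin 2) (s : ℝ) : Continuous fun t => linePt j s t :=
  (continuous_linePt j).comp (Continuous.prodMk_right s)

theorem ofReal_integral_le_lintegral_ofReal {α : Type*} [MeasurableSpace α] {μ : Measure α}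
    (f : α → ℝ) : ENNReal.ofReal (∫ x, f x ∂μ) ≤ ∫⁻ x, ENNReal.ofReal (f x) ∂μ := by
  by_cases hf : Integrable f μ
  · rw [integral_eq_lintegral_pos_part_sub_lintegral_neg_part hf]
    refine (ENNReal.ofReal_le_ofReal (sub_le_self _ ENNReal.toReal_nonneg)).trans ?_
    exact ENNReal.ofReal_toReal_le
  · simp [integral_undef hf]

/-- Slicing: integrals against derivatives are controlled by the variations along lines. -/
theorem pairing_le_lintegral_eVariationOn {u ψ : Plane → ℝ} (hu : Continuous u) (h : IsTest ψ)
    (j : Fin 2) :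
    ENNReal.ofReal (pairing u ψ j) ≤
      ∫⁻ s in Ioo (0 : ℝ) 1, eVariationOn (fun t => u (linePt j s t)) (Icc 0 1) := by
  have hint := h.integrable hu j
  have e1 : pairing u ψ j = ∫ s in Ioo (0 : ℝ) 1, ∫ t in Ioo (0 : ℝ) 1,
      u (linePt j s t) * fderiv ℝ ψ (linePt j s t) (e2 j) := by
    rw [pairing, ← (measurePreserving_linePt j).setIntegral_preimage_emb
      (measurableEmbedding_linePt j), preimage_linePt_unitSq, Measure.volume_eq_prod,
      setIntegral_prod]
    have := ((measurePreserving_linePt j).integrable_comp_emb (measurableEmbedding_linePt j)).2 hint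
    exact this.integrableOn
  rw [e1]
  refine (ofReal_integral_le_lintegral_ofReal _).trans ?_
  refine lintegral_mono fun s => ?_
  have hz : ∀ x ∉ unitSq, ψ x = 0 := fun x hx =>
    image_eq_zero_of_notMem_tsupport fun hx' => hx (h.2.2.1 hx')
  rw [← integral_Ioc_eq_integral_Ioo, ← intervalIntegral.integral_of_le zero_le_one]
  refine integral_mul_deriv_le_eVariationOn (ψ := fun t => ψ (linePt j s t))
    (hu.comp (continuous_linePt_right j s)) (fun t => ?_)
    ((h.continuous_deriv j).comp (continuous_linePt_right j s)) ?_ ?_ fun t => h.2.2.2 _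
  · exact ((h.1.differentiable one_ne_zero) _).hasFDerivAt.comp_hasDerivAt t
      (hasDerivAt_linePt j s t)
  · refine hz _ fun hx => ?_
    exact lt_irrefl _ (linePt_mem_unitSq.1 hx).2.1
  · refine hz _ fun hx => ?_
    exact lt_irrefl _ (linePt_mem_unitSq.1 hx).2.2

/-- The sum over lines in direction `j` of the variations of `u`. -/
def lineVar (u : Plane → ℝ) (j : Fin 2) : ℝ≥0∞ :=
  ∫⁻ s in Ioo (0 : ℝ) 1, eVariationOn (fun t => u (linePt j s t)) (Icc 0 1)

theorem isTest_zero : IsTest 0 := by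
  refine ⟨contDiff_const, HasCompactSupport.zero, ?_, by simp⟩
  simp [tsupport]

theorem pairing_zero (u : Plane → ℝ) (j : Fin 2) : pairing u 0 j = 0 := by
  simp [pairing]

theorem setIntegral_eq_sum_pairing {G : Plane → Plane} (hG : Continuous G)
    {ψ : Fin 2 → Fin 2 → Plane → ℝ} (h : ∀ i j, IsTest (ψ i j)) :
    ∫ x in unitSq, ((G x 0) * (fderiv ℝ (ψ 0 0) x (e2 0) + fderiv ℝ (ψ 0 1) x (e2 1))
        + (G x 1) * (fderiv ℝ (ψ 1 0) x (e2 0) + fderiv ℝ (ψ 1 1) x (e2 1)))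
      = ∑ i, ∑ j, pairing (fun x => G x i) (ψ i j) j := by
  have hi : ∀ i j, IntegrableOn (fun x => G x i * fderiv ℝ (ψ i j) x (e2 j)) unitSq := fun i j =>
    ((h i j).integrable ((continuous_coord i).comp hG) j).integrableOn
  simp only [Fin.sum_univ_two, pairing, mul_add]
  rw [← integral_add (hi 0 0) (hi 0 1), ← integral_add (hi 1 0) (hi 1 1)]
  exact integral_add ((hi 0 0).add (hi 0 1)) ((hi 1 0).add (hi 1 1))

theorem exists_tests_of_mem_varSet {G : Plane → Plane} (hG : Continuous G) {v : ℝ}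
    (hv : v ∈ varSet G unitSq) : ∃ ψ : Fin 2 → Fin 2 → Plane → ℝ, (∀ i j, IsTest (ψ i j)) ∧
      v = ∑ i, ∑ j, pairing (fun x => G x i) (ψ i j) j := by
  obtain ⟨φ, hφ, hc, hs, hb, rfl⟩ := hv
  have key : ∀ l : Plane × Plane →L[ℝ] ℝ, (∀ x, |l (φ x)| ≤ 1) → IsTest fun y => l (φ y) := by
    intro l hl
    refine ⟨l.contDiff.comp hφ, hc.comp_left (g := l) (map_zero l), ?_, hl⟩
    exact (closure_mono (Function.support_comp_subset (map_zero l) φ)).trans hs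
  let l : Fin 2 → Fin 2 → Plane × Plane →L[ℝ] ℝ := fun i j =>
    if i = 0 then (EuclideanSpace.proj j).comp (ContinuousLinearMap.fst ℝ Plane Plane)
    else (EuclideanSpace.proj j).comp (ContinuousLinearMap.snd ℝ Plane Plane)
  have ht : ∀ i j, IsTest fun y => l i j (φ y) := by
    intro i j
    refine key _ fun x => ?_
    fin_cases i
    · exact (hb x j).1
    · exact (hb x j).2
  exact ⟨fun i j y => l i j (φ y), ht, setIntegral_eq_sum_pairing hG ht⟩

theorem mem_varSet_of_tests {G : Plane → Plane} (hG : Continuous G)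
    {ψ : Fin 2 → Fin 2 → Plane → ℝ} (h : ∀ i j, IsTest (ψ i j)) :
    ∑ i, ∑ j, pairing (fun x => G x i) (ψ i j) j ∈ varSet G unitSq := by
  let vec : (Fin 2 → Plane → ℝ) → Plane → Plane := fun f x => !₂[f 0 x, f 1 x]
  have hvec : ∀ f : Fin 2 → Plane → ℝ, (∀ j, IsTest (f j)) →
      ContDiff ℝ 1 (vec f) ∧ ∀ x ∉ tsupport (f 0) ∪ tsupport (f 1), vec f x = 0 := by
    intro f hf
    refine ⟨contDiff_euclidean.2 fun i => ?_, fun x hx => ?_⟩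
    · fin_cases i
      · exact (hf 0).1
      · exact (hf 1).1
    · rw [mem_union, not_or] at hx
      refine plane_ext ?_ ?_
      · exact (image_eq_zero_of_notMem_tsupport hx.1 : f 0 x = 0)
      · exact (image_eq_zero_of_notMem_tsupport hx.2 : f 1 x = 0)
  set K := (tsupport (ψ 0 0) ∪ tsupport (ψ 0 1)) ∪ (tsupport (ψ 1 0) ∪ tsupport (ψ 1 1)) with hK
  have hKc : IsCompact K := ((h 0 0).2.1.isCompact.union (h 0 1).2.1.isCompact).union
    ((h 1 0).2.1.isCompact.union (h 1 1).2.1.isCompact)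
  have hKs : K ⊆ unitSq := union_subset (union_subset (h 0 0).2.2.1 (h 0 1).2.2.1)
    (union_subset (h 1 0).2.2.1 (h 1 1).2.2.1)
  have hz : ∀ x ∉ K, (vec (ψ 0) x, vec (ψ 1) x) = 0 := by
    intro x hx
    rw [hK, mem_union, not_or] at hx
    rw [(hvec _ (h 0)).2 x hx.1, (hvec _ (h 1)).2 x hx.2]; rfl
  have hsupp : tsupport (fun x => (vec (ψ 0) x, vec (ψ 1) x)) ⊆ K :=
    closure_minimal (fun x hx => by
      by_contra hxK
      exact hx (hz x hxK)) hKc.isClosed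
  refine ⟨fun x => (vec (ψ 0) x, vec (ψ 1) x), (hvec _ (h 0)).1.prodMk (hvec _ (h 1)).1,
    HasCompactSupport.of_support_subset_isCompact hKc (subset_closure.trans hsupp),
    hsupp.trans hKs, ?_, ?_⟩
  · intro x i
    fin_cases i
    · exact ⟨(h 0 0).2.2.2 x, (h 1 0).2.2.2 x⟩
    · exact ⟨(h 0 1).2.2.2 x, (h 1 1).2.2.2 x⟩
  · exact (setIntegral_eq_sum_pairing hG h).symm

theorem ofReal_le_lineVar_of_mem_varSet {G : Plane → Plane} (hG : Continuous G) {v : ℝ}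
    (hv : v ∈ varSet G unitSq) :
    ENNReal.ofReal v ≤ ∑ i, ∑ j, lineVar (fun x => G x i) j := by
  obtain ⟨ψ, hψ, rfl⟩ := exists_tests_of_mem_varSet hG hv
  have hle : ∀ i j, ENNReal.ofReal (pairing (fun x => G x i) (ψ i j) j) ≤
      lineVar (fun x => G x i) j := fun i j =>
    pairing_le_lintegral_eVariationOn ((continuous_coord i).comp hG) (hψ i j) j
  simp only [Fin.sum_univ_two]
  refine ENNReal.ofReal_add_le.trans (add_le_add ?_ ?_) <;>
  exact ENNReal.ofReal_add_le.trans (add_le_add (hle _ _) (hle _ _))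

theorem varSet_nonempty (G : Plane → Plane) : (varSet G unitSq).Nonempty :=
  ⟨0, 0, contDiff_const, HasCompactSupport.zero, by simp [tsupport], by simp, by simp⟩

/-- A bound for the sum of the line variations bounds the variation. -/
theorem var_le_of_lineVar_le {G : Plane → Plane} (hG : Continuous G) {C : ℝ} (hC : 0 ≤ C)
    (h : ∑ i, ∑ j, lineVar (fun x => G x i) j ≤ ENNReal.ofReal C) :
    BddAbove (varSet G unitSq) ∧ Var G unitSq ≤ C := by
  have hle : ∀ v ∈ varSet G unitSq, v ≤ C := fun v hv =>
    (ENNReal.ofReal_le_ofReal_iff hC).1 ((ofReal_le_lineVar_of_mem_varSet hG hv).trans h)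
  exact ⟨⟨C, hle⟩, csSup_le (varSet_nonempty G) hle⟩

/-- The variation dominates the sum of the four directional variations. -/
theorem exists_directional_bounds {G : Plane → Plane} (hG : Continuous G)
    (hb : BddAbove (varSet G unitSq)) : ∃ D : Fin 2 → Fin 2 → ℝ,
      (∀ i j, 0 ≤ D i j) ∧
      (∀ i j ψ, IsTest ψ → pairing (fun x => G x i) ψ j ≤ D i j) ∧
      ∑ i, ∑ j, D i j ≤ Var G unitSq := by
  classical
  let P : Fin 2 → Fin 2 → Set ℝ := fun i j => {v | ∃ ψ, IsTest ψ ∧ v = pairing (fun x => G x i) ψ j}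
  have hP0 : ∀ i j, (0 : ℝ) ∈ P i j := fun i j => ⟨0, isTest_zero, (pairing_zero _ _).symm⟩
  have hPb : ∀ i j, BddAbove (P i j) := by
    intro i j
    obtain ⟨C, hC⟩ := hb
    refine ⟨C, ?_⟩
    rintro _ ⟨ψ, hψ, rfl⟩
    have := mem_varSet_of_tests hG (ψ := fun i' j' => if i' = i ∧ j' = j then ψ else 0)
      (fun i' j' => by split_ifs; exacts [hψ, isTest_zero])
    have h2 := hC this
    refine le_trans (le_of_eq ?_) h2
    fin_cases i <;> fin_cases j <;> simp [Fin.sum_univ_two, pairing_zero]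
  refine ⟨fun i j => sSup (P i j), fun i j => le_csSup (hPb i j) (hP0 i j),
    fun i j ψ hψ => le_csSup (hPb i j) ⟨ψ, hψ, rfl⟩, le_of_forall_pos_le_add fun ε hε => ?_⟩
  have : ∀ i j, ∃ ψ, IsTest ψ ∧ sSup (P i j) - ε / 4 < pairing (fun x => G x i) ψ j := by
    intro i j
    obtain ⟨_, ⟨ψ, hψ, rfl⟩, h⟩ := exists_lt_of_lt_csSup ⟨0, hP0 i j⟩
      (sub_lt_self (sSup (P i j)) (by positivity : 0 < ε / 4))
    exact ⟨ψ, hψ, h⟩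
  choose ψ hψ hlt using this
  have h1 := le_csSup hb (mem_varSet_of_tests hG hψ)
  simp only [Fin.sum_univ_two] at h1 ⊢
  change _ ≤ Var G unitSq at h1
  linarith [hlt 0 0, hlt 0 1, hlt 1 0, hlt 1 1]

theorem var_nonneg {G : Plane → Plane} (hb : BddAbove (varSet G unitSq)) : 0 ≤ Var G unitSq :=
  le_csSup hb ⟨0, contDiff_const, HasCompactSupport.zero, by simp [tsupport], by simp, by simp⟩

theorem contDiff_and_fderiv_convolution {f η : Plane → ℝ} (hf : LocallyIntegrable f volume)
    (hη : ContDiff ℝ 1 η) (hc : HasCompactSupport η) :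
    ContDiff ℝ 1 (fun x => ∫ t, f t * η (x - t)) ∧ ∀ x v,
      fderiv ℝ (fun x => ∫ t, f t * η (x - t)) x v = ∫ t, f t * fderiv ℝ η (x - t) v := by
  refine ⟨hc.contDiff_convolution_right (n := 1) (ContinuousLinearMap.lsmul ℝ ℝ) hf hη,
    fun x v => ?_⟩
  have h1 := hc.hasFDerivAt_convolution_right (ContinuousLinearMap.lsmul ℝ ℝ) hf hη x
  have h2 := convolution_precompR_apply (ContinuousLinearMap.lsmul ℝ ℝ) hf
    (hc.fderiv (𝕜 := ℝ)) (hη.continuous_fderiv one_ne_zero) x v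
  have h3 := h1.fderiv
  change fderiv ℝ (fun x => ∫ t, f t * η (x - t)) x = _ at h3
  rw [h3, h2]
  rfl

/-- The closed square at distance `a` from the boundary of the unit square. -/
def innerSq (a : ℝ) : Set Plane := {x | ∀ i, x i ∈ Icc a (1 - a)}

theorem isClosed_innerSq (a : ℝ) : IsClosed (innerSq a) := by
  have : innerSq a = ⋂ i, (fun x : Plane => x i) ⁻¹' Icc a (1 - a) := by
    ext x; simp [innerSq]
  rw [this]
  exact isClosed_iInter fun i => isClosed_Icc.preimage (continuous_coord i)

theorem innerSq_subset_unitSq {a : ℝ} (ha : 0 < a) : innerSq a ⊆ unitSq := fun x hx =>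
  ⟨by linarith [(hx 0).1], by linarith [(hx 0).2], by linarith [(hx 1).1], by linarith [(hx 1).2]⟩

theorem abs_coord_le_norm (x : Plane) (i : Fin 2) : |x i| ≤ ‖x‖ := by
  simpa using PiLp.norm_apply_le x i

theorem norm_le_abs_add_abs (x : Plane) : ‖x‖ ≤ |x 0| + |x 1| := by
  rw [EuclideanSpace.norm_eq, Fin.sum_univ_two]
  refine Real.sqrt_le_iff.2 ⟨by positivity, ?_⟩
  simp only [Real.norm_eq_abs]
  nlinarith [abs_nonneg (x 0), abs_nonneg (x 1)]

theorem isBounded_unitSq : Bornology.IsBounded unitSq := by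
  refine (Metric.isBounded_closedBall (x := (0 : Plane)) (r := 2)).subset fun x hx => ?_
  rw [mem_closedBall_zero_iff]
  refine (norm_le_abs_add_abs x).trans ?_
  rw [abs_of_pos hx.1, abs_of_pos hx.2.2.1]
  linarith [hx.2.1, hx.2.2.2]

theorem isCompact_innerSq {a : ℝ} (ha : 0 < a) : IsCompact (innerSq a) :=
  Metric.isCompact_of_isClosed_isBounded (isClosed_innerSq a)
    (isBounded_unitSq.subset (innerSq_subset_unitSq ha))

theorem integrableOn_unitSq {u : Plane → ℝ} (hu : Continuous u) : IntegrableOn u unitSq :=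
  (hu.continuousOn.integrableOn_compact
    (Metric.isCompact_of_isClosed_isBounded isClosed_closure isBounded_unitSq.closure)).mono_set
    subset_closure

theorem mem_innerSq_of_dist {a r : ℝ} {x y : Plane} (hx : x ∈ innerSq (a + r))
    (h : ‖y - x‖ ≤ r) : y ∈ innerSq a := fun i => by
  have h1 := (abs_coord_le_norm (y - x) i).trans h
  rw [abs_le] at h1
  simp only [PiLp.sub_apply] at h1
  have := hx i
  constructor <;> linarith [this.1, this.2]

/-- The mollified function has a derivative with small integral over an inner square. -/
theorem lintegral_innerSq_fderiv_le {u : Plane → ℝ} (hu : Continuous u) {j : Fin 2} {D : ℝ}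
    (hD : ∀ ψ, IsTest ψ → pairing u ψ j ≤ D) (ρ : ContDiffBump (0 : Plane)) :
    ∫⁻ x in innerSq (2 * ρ.rOut), ENNReal.ofReal
      |fderiv ℝ (fun x => ∫ t, u t * ρ.normed volume (x - t)) x (e2 j)| ≤ ENNReal.ofReal D := by
  set r := ρ.rOut with hr
  have hr0 : 0 < r := ρ.rOut_pos
  set η := ρ.normed (volume : Measure Plane) with hη
  have hηc : ContDiff ℝ 1 η := ρ.contDiff_normed (n := 1)
  have hηs : HasCompactSupport η := ρ.hasCompactSupport_normed
  set κ : Plane → ℝ := fun z => fderiv ℝ η z (e2 j) with hκ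
  have hκc : Continuous κ := (hηc.continuous_fderiv one_ne_zero).clm_apply continuous_const
  have hκs : tsupport κ ⊆ Metric.closedBall 0 r := by
    rw [← ρ.tsupport_normed_eq (μ := volume)]
    exact tsupport_fderiv_apply_subset ℝ (e2 j)
  have hκz : ∀ z, r < ‖z‖ → κ z = 0 := fun z hz => by
    refine image_eq_zero_of_notMem_tsupport fun h => ?_
    have := hκs h
    rw [mem_closedBall_zero_iff] at this
    linarith
  have hκodd : ∀ z, κ (-z) = -κ z := by
    intro z
    have h1 : (fun z => η (-z)) = η := funext fun z => ρ.normed_neg z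
    have h2 : HasFDerivAt (fun z => η (-z)) ((fderiv ℝ η (-z)).comp (-ContinuousLinearMap.id ℝ Plane)) z :=
      ((hηc.differentiable one_ne_zero) (-z)).hasFDerivAt.comp z (hasFDerivAt_id z).neg
    rw [h1] at h2
    simp only [hκ]
    rw [h2.fderiv]
    simp
  set d : Plane → ℝ := fun x => fderiv ℝ (fun x => ∫ t, u t * η (x - t)) x (e2 j) with hd
  obtain ⟨hF1, hF2⟩ := contDiff_and_fderiv_convolution hu.locallyIntegrable hηc hηs
  have hdc : Continuous d := (hF1.continuous_fderiv one_ne_zero).clm_apply continuous_const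
  have hdf : ∀ x, d x = ∫ t, u t * κ (x - t) := fun x => hF2 x (e2 j)
  set K := innerSq (2 * r) with hK
  have hKm : MeasurableSet K := (isClosed_innerSq _).measurableSet
  have hKc : IsCompact K := isCompact_innerSq (by positivity)
  set χ : Plane → ℝ := K.indicator fun x => if 0 < d x then -1 else 1 with hχ
  have hχm : Measurable χ := (Measurable.ite (measurableSet_lt measurable_const hdc.measurable)
    measurable_const measurable_const).indicator hKm
  have hχb : ∀ x, |χ x| ≤ 1 := by
    intro x
    simp only [hχ, indicator]
    split_ifs <;> simp
  have hχi : Integrable χ := by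
    refine (integrable_indicator_iff hKm).2 ?_
    refine Measure.integrableOn_of_bounded (M := 1) hKc.measure_lt_top.ne
      (Measurable.ite (measurableSet_lt measurable_const hdc.measurable)
        measurable_const measurable_const).aestronglyMeasurable ?_
    refine Eventually.of_forall fun x => ?_
    split_ifs <;> simp
  obtain ⟨hψ1, hψ2⟩ := contDiff_and_fderiv_convolution hχi.locallyIntegrable hηc hηs
  set ψ : Plane → ℝ := fun x => ∫ t, χ t * η (x - t) with hψ
  have hψz : ∀ x ∉ innerSq r, ψ x = 0 := by
    intro x hx
    refine integral_eq_zero_of_ae (Eventually.of_forall fun t => ?_)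
    by_cases ht : t ∈ K
    · have : η (x - t) = 0 := by
        refine image_eq_zero_of_notMem_tsupport fun h => hx ?_
        rw [hη, ρ.tsupport_normed_eq, mem_closedBall_zero_iff] at h
        refine mem_innerSq_of_dist (r := r) (x := t) ?_ h
        rw [← two_mul]; exact ht
      simp [this]
    · simp [hχ, ht]
  have hψt : tsupport ψ ⊆ innerSq r := closure_minimal (fun x hx => by
    by_contra h
    exact hx (hψz x h)) (isClosed_innerSq r)
  have htest : IsTest ψ := by
    refine ⟨hψ1, ?_, hψt.trans (innerSq_subset_unitSq hr0), fun x => ?_⟩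
    · exact HasCompactSupport.of_support_subset_isCompact (isCompact_innerSq hr0)
        (subset_closure.trans hψt)
    · have h1 : ∫ t, η (x - t) = 1 := by
        rw [integral_sub_left_eq_self]; exact ρ.integral_normed
      rw [← h1]
      refine abs_integral_le_integral_abs.trans ?_
      refine integral_mono_of_nonneg (Eventually.of_forall fun t => abs_nonneg _)
        ((ρ.integrable_normed (μ := volume)).comp_sub_left x) (Eventually.of_forall fun t => ?_)
      change |χ t * η (x - t)| ≤ η (x - t)
      rw [abs_mul, abs_of_nonneg (ρ.nonneg_normed (x - t) : 0 ≤ η (x - t))]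
      exact mul_le_of_le_one_left (ρ.nonneg_normed (x - t)) (hχb t)
  have hp : pairing u ψ j = ∫ x in K, |d x| := by
    obtain ⟨C, hC⟩ : ∃ C, ∀ z, ‖κ z‖ ≤ C :=
      hκc.bounded_above_of_compact_support (HasCompactSupport.of_support_subset_isCompact
        (isCompact_closedBall 0 r) (subset_closure.trans hκs))
    have hint : Integrable (Function.uncurry fun x t => u x * (χ t * κ (x - t)))
        ((volume.restrict unitSq).prod volume) := by
      refine Integrable.mono' (((integrableOn_unitSq hu).mul_prod hχi).norm.mul_const C) ?_ ?_
      · refine Measurable.aestronglyMeasurable ?_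
        exact (hu.measurable.comp measurable_fst).mul ((hχm.comp measurable_snd).mul
          (hκc.measurable.comp (measurable_fst.sub measurable_snd)))
      · refine Eventually.of_forall fun p => ?_
        change ‖u p.1 * (χ p.2 * κ (p.1 - p.2))‖ ≤ _
        rw [← mul_assoc, norm_mul]
        exact mul_le_mul_of_nonneg_left (hC _) (norm_nonneg _)
    have e1 : pairing u ψ j = ∫ x in unitSq, ∫ t, u x * (χ t * κ (x - t)) := by
      refine integral_congr_ae (Eventually.of_forall fun x => ?_)
      change u x * fderiv ℝ ψ x (e2 j) = _
      rw [hψ2]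
      exact (integral_const_mul _ _).symm
    rw [e1, integral_integral_swap hint, ← integral_indicator hKm]
    refine integral_congr_ae (Eventually.of_forall fun t => ?_)
    change ∫ x in unitSq, u x * (χ t * κ (x - t)) = K.indicator (fun x => |d x|) t
    by_cases ht : t ∈ K
    · rw [setIntegral_eq_integral_of_forall_compl_eq_zero]
      · have e2 : ∀ x, u x * (χ t * κ (x - t)) = -χ t * (u x * κ (t - x)) := fun x => by
          rw [← neg_sub t x, hκodd]; ring
        simp only [e2]
        rw [integral_const_mul, ← hdf, indicator_of_mem ht]
        simp only [hχ, indicator_of_mem ht]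
        split_ifs with h
        · rw [abs_of_pos h]; ring
        · rw [abs_of_nonpos (not_lt.1 h)]; ring
      · intro x hx
        have : κ (x - t) = 0 := by
          refine hκz _ ?_
          by_contra h
          refine hx (innerSq_subset_unitSq hr0 (mem_innerSq_of_dist (r := r) (x := t) ?_ (not_lt.1 h)))
          rw [← two_mul]; exact ht
        simp [this]
    · simp [hχ, ht]
  rw [← ofReal_integral_eq_lintegral_ofReal (hdc.abs.continuousOn.integrableOn_compact hKc)
    (Eventually.of_forall fun x => abs_nonneg _), ← hp]
  exact ENNReal.ofReal_le_ofReal (hD ψ htest)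

theorem preimage_linePt_innerSq (j : Fin 2) (a : ℝ) :
    (fun p : ℝ × ℝ => linePt j p.1 p.2) ⁻¹' innerSq a = Icc a (1 - a) ×ˢ Icc a (1 - a) := by
  ext ⟨s, t⟩
  fin_cases j <;> simp [linePt, innerSq, Fin.forall_fin_two] <;> tauto

theorem lintegral_innerSq {f : Plane → ℝ≥0∞} (hf : Measurable f) (j : Fin 2) (a : ℝ) :
    ∫⁻ x in innerSq a, f x = ∫⁻ s in Icc a (1 - a), ∫⁻ t in Icc a (1 - a), f (linePt j s t) := by
  rw [← (measurePreserving_linePt j).setLIntegral_comp_preimage_emb (measurableEmbedding_linePt j),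
    preimage_linePt_innerSq, Measure.volume_eq_prod, ← Measure.prod_restrict, lintegral_prod]
  exact (hf.comp (continuous_linePt j).measurable).aemeasurable

/-- Slicing, converse direction: the directional variation bounds the line variations by a
measurable function. -/
theorem exists_measurable_line_bound {u : Plane → ℝ} (hu : Continuous u) {j : Fin 2} {D : ℝ}
    (hD : ∀ ψ, IsTest ψ → pairing u ψ j ≤ D) :
    ∃ W : ℝ → ℝ≥0∞, Measurable W ∧
      (∀ s ∈ Ioo (0 : ℝ) 1, eVariationOn (fun t => u (linePt j s t)) (Icc 0 1) ≤ W s) ∧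
      ∫⁻ s in Ioo (0 : ℝ) 1, W s ≤ ENNReal.ofReal D := by
  let r : ℕ → ℝ := fun n => 1 / ((n : ℝ) + 5)
  have hr0 : ∀ n, 0 < r n := fun n => by positivity
  have hr5 : ∀ n, r n ≤ 1 / 5 := fun n => by
    refine one_div_le_one_div_of_le (by norm_num) ?_
    linarith [(Nat.cast_nonneg n : (0 : ℝ) ≤ n)]
  have hrt : Tendsto r atTop (𝓝 0) := by
    have := tendsto_natCast_atTop_atTop (R := ℝ)
    exact (tendsto_const_nhds (x := (1 : ℝ))).div_atTop (this.atTop_add tendsto_const_nhds)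
  let ρ : ℕ → ContDiffBump (0 : Plane) := fun n => ⟨r n / 2, r n, by linarith [hr0 n], by linarith [hr0 n]⟩
  let U : ℕ → Plane → ℝ := fun n x => ∫ t, u t * (ρ n).normed volume (x - t)
  let d : ℕ → Plane → ℝ := fun n x => fderiv ℝ (U n) x (e2 j)
  have hU : ∀ n, ContDiff ℝ 1 (U n) := fun n =>
    (contDiff_and_fderiv_convolution hu.locallyIntegrable ((ρ n).contDiff_normed (n := 1))
      (ρ n).hasCompactSupport_normed).1
  have hdc : ∀ n, Continuous (d n) := fun n =>
    ((hU n).continuous_fderiv one_ne_zero).clm_apply continuous_const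
  have hdm : ∀ n, Measurable fun x => ENNReal.ofReal |d n x| := fun n =>
    (hdc n).abs.measurable.ennreal_ofReal
  let I : ℕ → Set ℝ := fun n => Icc (2 * r n) (1 - 2 * r n)
  have hI : ∀ n, 2 * r n ≤ 1 - 2 * r n := fun n => by linarith [hr5 n]
  let w : ℕ → ℝ → ℝ≥0∞ := fun n s => ∫⁻ t in I n, ENNReal.ofReal |d n (linePt j s t)|
  have hw : ∀ n, Measurable (w n) := fun n =>
    Measurable.lintegral_prod_right' (f := fun p : ℝ × ℝ => ENNReal.ofReal |d n (linePt j p.1 p.2)|)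
      ((hdm n).comp (continuous_linePt j).measurable)
  have hWm : ∀ n, Measurable ((I n).indicator (w n)) := fun n => (hw n).indicator measurableSet_Icc
  refine ⟨fun s => liminf (fun n => (I n).indicator (w n) s) atTop, Measurable.liminf hWm, ?_, ?_⟩
  · intro s hs
    refine le_of_forall_lt fun v hv => ?_
    obtain ⟨v', hv1, hv2⟩ := exists_between hv
    refine hv1.trans_le ?_
    let cl : ℕ → ℝ → ℝ := fun n t => max (2 * r n) (min t (1 - 2 * r n))
    have hconv : ∀ t ∈ Icc (0 : ℝ) 1, Tendsto (fun n => U n (linePt j s (cl n t))) atTop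
        (𝓝 (u (linePt j s t))) := by
      intro t ht
      have h2r : Tendsto (fun n => 2 * r n) atTop (𝓝 0) := by simpa using hrt.const_mul 2
      have hcl : Tendsto (fun n => cl n t) atTop (𝓝 t) := by
        have := h2r.max ((tendsto_const_nhds (x := t)).min (h2r.const_sub 1))
        simpa [ht.1, ht.2] using this
      have := ContDiffBump.convolution_tendsto_right (μ := (volume : Measure Plane)) (φ := ρ)
        (g := fun _ => u) (l := atTop)
        (k := fun n => linePt j s (cl n t)) (x₀ := linePt j s t) (z₀ := u (linePt j s t)) hrt
        (Eventually.of_forall fun _ => hu.aestronglyMeasurable)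
        ((hu.tendsto _).comp tendsto_snd)
        (((continuous_linePt_right j s).tendsto t).comp hcl)
      refine this.congr fun n => ?_
      rw [convolution_lsmul_swap]
      refine integral_congr_ae (Eventually.of_forall fun t => ?_)
      exact mul_comm _ _
    have hev := eVariationOn.lowerSemicontinuous_aux hconv hv2
    have hsI : ∀ᶠ n in atTop, s ∈ I n := by
      have h2r : Tendsto (fun n => 2 * r n) atTop (𝓝 0) := by simpa using hrt.const_mul 2
      filter_upwards [h2r.eventually_lt_const hs.1,
        h2r.eventually_lt_const (sub_pos.2 hs.2)] with n h1 h2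
      exact ⟨h1.le, by linarith⟩
    refine le_liminf_of_le (by isBoundedDefault) ?_
    filter_upwards [hev, hsI] with n h1 h2
    refine h1.le.trans ?_
    rw [indicator_of_mem h2]
    have hmono : MonotoneOn (cl n) (Icc 0 1) := fun x _ y _ hxy => by
      simp only [cl]; gcongr
    refine (eVariationOn.comp_le_of_monotoneOn (fun t => U n (linePt j s t)) (s := I n) (cl n) hmono
      fun t _ => ⟨le_max_left _ _, max_le (hI n) (min_le_right _ _)⟩).trans ?_
    refine eVariationOn_le_lintegral_deriv (hI n) (fun t => ?_)
      ((hdc n).comp (continuous_linePt_right j s))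
    exact ((hU n).differentiable one_ne_zero _).hasFDerivAt.comp_hasDerivAt t (hasDerivAt_linePt j s t)
  · refine (setLIntegral_le_lintegral _ _).trans ((lintegral_liminf_le hWm).trans ?_)
    refine (liminf_le_liminf (v := fun _ => ENNReal.ofReal D) (Eventually.of_forall fun n => ?_)).trans
      (liminf_const _).le
    change ∫⁻ s, (I n).indicator (w n) s ≤ _
    rw [lintegral_indicator measurableSet_Icc]
    change ∫⁻ s in I n, ∫⁻ t in I n, ENNReal.ofReal |d n (linePt j s t)| ≤ _
    rw [← lintegral_innerSq (hdm n)]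
    exact lintegral_innerSq_fderiv_le hu hD (ρ n)

/-- The homeomorphism is the identity outside the unit square. -/
def FixOff (G : Plane ≃ₜ Plane) : Prop := ∀ x ∉ unitSq, G x = x

theorem FixOff.symm {G : Plane ≃ₜ Plane} (h : FixOff G) : FixOff G.symm := fun x hx => by
  rw [Homeomorph.symm_apply_eq, h x hx]

theorem FixOff.mapsTo {G : Plane ≃ₜ Plane} (h : FixOff G) : MapsTo G unitSq unitSq := by
  intro x hx
  by_contra hn
  have := G.injective (h _ hn)
  rw [this] at hn
  exact hn hx

theorem FixOff.isHomeoOn {G : Plane ≃ₜ Plane} (h : FixOff G) :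
    IsHomeoOn G G.symm unitSq unitSq := by
  refine ⟨⟨h.mapsTo, G.injective.injOn, fun y hy => ⟨G.symm y, h.symm.mapsTo hy, G.apply_symm_apply y⟩⟩,
    G.continuous.continuousOn, ⟨fun x _ => G.symm_apply_apply x, fun x _ => G.apply_symm_apply x⟩,
    G.symm.continuous.continuousOn⟩

theorem frontier_unitSq_notMem {x : Plane} (hx : x ∈ frontier unitSq) : x ∉ unitSq := by
  rw [isOpen_unitSq.frontier_eq] at hx
  exact hx.2

theorem FixOff.extendsToId {G : Plane ≃ₜ Plane} (h : FixOff G) : ExtendsToId G :=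
  ⟨G.continuous.continuousOn, fun _ hx => h _ (frontier_unitSq_notMem hx)⟩

theorem varSet_congr {f g : Plane → Plane} (h : EqOn f g unitSq) :
    varSet f unitSq = varSet g unitSq := by
  have key : ∀ φ : Plane → Plane × Plane,
      (∫ x in unitSq, ((f x 0) * (fderiv ℝ (fun y => (φ y).1 0) x (e2 0)
                    + fderiv ℝ (fun y => (φ y).1 1) x (e2 1))
        + (f x 1) * (fderiv ℝ (fun y => (φ y).2 0) x (e2 0)
                    + fderiv ℝ (fun y => (φ y).2 1) x (e2 1)))) =
      ∫ x in unitSq, ((g x 0) * (fderiv ℝ (fun y => (φ y).1 0) x (e2 0)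
                    + fderiv ℝ (fun y => (φ y).1 1) x (e2 1))
        + (g x 1) * (fderiv ℝ (fun y => (φ y).2 0) x (e2 0)
                    + fderiv ℝ (fun y => (φ y).2 1) x (e2 1))) := fun φ =>
    setIntegral_congr_fun isOpen_unitSq.measurableSet fun x hx => by simp only [h hx]
  unfold varSet
  simp only [key]

theorem exists_homeomorph_of_eq_off {F : Plane → Plane} (hc : Continuous F)
    (hb : Function.Bijective F) (hoff : ∀ x ∉ unitSq, F x = x) :
    ∃ G : Plane ≃ₜ Plane, (G : Plane → Plane) = F := by
  have hcl : IsClosedMap F := by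
    have : IsProperMap F := by
      refine isProperMap_iff_tendsto_cocompact.2 ⟨hc, ?_⟩
      have hK : IsCompact (closure unitSq) :=
        Metric.isCompact_of_isClosed_isBounded isClosed_closure isBounded_unitSq.closure
      refine tendsto_id.congr' ?_
      filter_upwards [hK.compl_mem_cocompact] with x hx
      exact (hoff x fun h => hx (subset_closure h)).symm
    exact this.isClosedMap
  exact ⟨(Equiv.ofBijective F hb).toHomeomorphOfContinuousClosed hc hcl, rfl⟩

theorem exists_homeomorph_of_mem_X {M : ℝ} {p : (Plane → Plane) × (Plane → Plane)}
    (hp : p ∈ X M) : ∃ G : Plane ≃ₜ Plane, FixOff G ∧ EqOn p.1 G unitSq ∧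
      EqOn p.2 G.symm unitSq := by
  classical
  obtain ⟨⟨hb, -, hinv, -⟩, ⟨hc, hid⟩, -, -⟩ := hp
  let F : Plane → Plane := unitSq.piecewise p.1 id
  have hF1 : ∀ x ∈ unitSq, F x = p.1 x := fun x hx => piecewise_eq_of_mem _ _ _ hx
  have hF2 : ∀ x ∉ unitSq, F x = x := fun x hx => piecewise_eq_of_notMem _ _ _ hx
  have hFc : Continuous F := continuous_piecewise (fun x hx => hid hx) hc continuous_id.continuousOn
  have hinj : Function.Injective F := by
    intro x y hxy
    by_cases hx : x ∈ unitSq <;> by_cases hy : y ∈ unitSq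
    · rw [hF1 x hx, hF1 y hy] at hxy; exact hb.injOn hx hy hxy
    · rw [hF1 x hx, hF2 y hy] at hxy; exact absurd (hxy ▸ hb.mapsTo hx) hy
    · rw [hF2 x hx, hF1 y hy] at hxy; exact absurd (hxy ▸ hb.mapsTo hy) hx
    · rw [hF2 x hx, hF2 y hy] at hxy; exact hxy
  have hsurj : Function.Surjective F := by
    intro y
    by_cases hy : y ∈ unitSq
    · obtain ⟨x, hx, rfl⟩ := hb.surjOn hy
      exact ⟨x, hF1 x hx⟩
    · exact ⟨y, hF2 y hy⟩
  obtain ⟨G, hG'⟩ := exists_homeomorph_of_eq_off hFc ⟨hinj, hsurj⟩ hF2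
  have hG : ∀ x, G x = F x := congrFun hG'
  refine ⟨G, fun x hx => (hG x).trans (hF2 x hx), fun x hx => ((hG x).trans (hF1 x hx)).symm, fun y hy => ?_⟩
  symm
  rw [Homeomorph.symm_apply_eq, hG]
  obtain ⟨x, hx, rfl⟩ := hb.surjOn hy
  rw [hinv.1 hx, hF1 x hx]

theorem FixOff.uniformContinuous {G : Plane ≃ₜ Plane} (h : FixOff G) : UniformContinuous G := by
  have h1 : HasCompactSupport fun x => G x - x :=
    HasCompactSupport.of_support_subset_isCompact
      (Metric.isCompact_of_isClosed_isBounded isClosed_closure isBounded_unitSq.closure)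
      fun x hx => subset_closure (by
        by_contra hn
        exact hx (by simp [h x hn]))
  have h2 : Continuous fun x => G x - x := G.continuous.sub continuous_id
  have h3 := (h2.uniformContinuous_of_tendsto_cocompact (x := 0) h1.is_zero_at_infty).add
    uniformContinuous_id
  simpa using h3

theorem supDist_le {f g : Plane → Plane} {η : ℝ} (hη : 0 ≤ η)
    (h : ∀ x ∈ unitSq, dist (f x) (g x) ≤ η) : supDist f g unitSq ≤ η :=
  Real.iSup_le (fun x => h x x.2) hη

theorem abs_sub_coord_le_dist (x y : Plane) (i : Fin 2) : |x i - y i| ≤ dist x y := by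
  rw [dist_eq_norm]; exact abs_coord_le_norm (x - y) i

theorem pairing_sub_le {u v ψ : Plane → ℝ} (hu : Continuous u) (hv : Continuous v) {j : Fin 2}
    (h : IsTest ψ) {η : ℝ} (huv : ∀ x ∈ unitSq, |u x - v x| ≤ η) :
    pairing u ψ j - pairing v ψ j ≤ η * ∫ x in unitSq, |fderiv ℝ ψ x (e2 j)| := by
  unfold pairing
  rw [← integral_sub (h.integrable hu j).integrableOn (h.integrable hv j).integrableOn,
    ← integral_const_mul]
  refine setIntegral_mono_on ((h.integrable hu j).sub (h.integrable hv j)).integrableOn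
    ((integrableOn_unitSq (h.continuous_deriv j).abs).const_mul η) isOpen_unitSq.measurableSet
    fun x hx => ?_
  rw [← sub_mul]
  refine (le_abs_self _).trans ?_
  rw [abs_mul]
  exact mul_le_mul_of_nonneg_right (huv x hx) (abs_nonneg _)

/-- Homeomorphisms uniformly close to a given element of `X`, whose line variations are almost
at most its variation, are close to it in the metric of `X`. -/
theorem exists_close_criterion {M : ℝ} {p : (Plane → Plane) × (Plane → Plane)} (hp : p ∈ X M)
    {G₀ : Plane ≃ₜ Plane} (h1 : EqOn p.1 G₀ unitSq) (h2 : EqOn p.2 G₀.symm unitSq)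
    {ε : ℝ} (hε : 0 < ε) : ∃ η > 0, ∀ G : Plane ≃ₜ Plane, FixOff G →
      (∀ x, dist (G₀ x) (G x) ≤ η) → (∀ x, dist (G₀.symm x) (G.symm x) ≤ η) →
      ∑ i, ∑ j, lineVar (fun x => G x i) j ≤ ENNReal.ofReal (Var p.1 unitSq + η) →
      ((G : Plane → Plane), (G.symm : Plane → Plane)) ∈ X M ∧
        dX M p ((G : Plane → Plane), (G.symm : Plane → Plane)) < ε := by
  obtain ⟨-, -, ⟨-, hbdd⟩, hM⟩ := hp
  set v₀ := Var p.1 unitSq with hv₀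
  have hvs : varSet p.1 unitSq = varSet G₀ unitSq := varSet_congr h1
  have hv₀' : v₀ = Var G₀ unitSq := by rw [hv₀, Var, Var, hvs]
  rw [hvs] at hbdd
  have hv0 : 0 ≤ v₀ := hv₀' ▸ var_nonneg hbdd
  have hcont : ContinuousAt (fun v => 1 / (M - v)) v₀ :=
    continuousAt_const.div (continuousAt_const.sub continuousAt_id) (sub_pos.2 hM).ne'
  obtain ⟨δ, hδ, hδc⟩ := Metric.continuousAt_iff.1 hcont (ε / 3) (by positivity)
  obtain ⟨v, hv, hlt⟩ := exists_lt_of_lt_csSup (varSet_nonempty G₀)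
    (show v₀ - δ / 2 < Var G₀ unitSq by rw [← hv₀']; linarith)
  obtain ⟨ψ, hψ, rfl⟩ := exists_tests_of_mem_varSet G₀.continuous hv
  set C := ∑ i, ∑ j, ∫ x in unitSq, |fderiv ℝ (ψ i j) x (e2 j)| with hC
  have hC0 : 0 ≤ C := Finset.sum_nonneg fun i _ => Finset.sum_nonneg fun j _ =>
    integral_nonneg fun x => abs_nonneg _
  set η := min (ε / 3) (min (δ / (2 * (C + 1))) (min (δ / 2) ((M - v₀) / 2))) with hη
  have hη0 : 0 < η := by
    have := sub_pos.2 hM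
    refine lt_min (by positivity) (lt_min (by positivity) (lt_min (by positivity) (by positivity)))
  have hη1 : η ≤ ε / 3 := min_le_left _ _
  have hη2 : η ≤ δ / (2 * (C + 1)) := (min_le_right _ _).trans (min_le_left _ _)
  have hη3 : η ≤ δ / 2 := (min_le_right _ _).trans ((min_le_right _ _).trans (min_le_left _ _))
  have hη4 : η ≤ (M - v₀) / 2 :=
    (min_le_right _ _).trans ((min_le_right _ _).trans (min_le_right _ _))
  have hηC : η * C < δ / 2 := by
    rw [le_div_iff₀ (by positivity)] at hη2
    nlinarith
  refine ⟨η, hη0, fun G hG hd1 hd2 hV => ?_⟩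
  obtain ⟨hGb, hGV⟩ := var_le_of_lineVar_le G.continuous (add_nonneg hv0 hη0.le) hV
  have hmem := le_csSup hGb (mem_varSet_of_tests G.continuous hψ)
  have hdiff : ∑ i, ∑ j, pairing (fun x => G₀ x i) (ψ i j) j -
      ∑ i, ∑ j, pairing (fun x => G x i) (ψ i j) j ≤ η * C := by
    rw [hC, Finset.mul_sum, ← Finset.sum_sub_distrib]
    refine Finset.sum_le_sum fun i _ => ?_
    rw [Finset.mul_sum, ← Finset.sum_sub_distrib]
    refine Finset.sum_le_sum fun j _ => ?_
    exact pairing_sub_le ((continuous_coord i).comp G₀.continuous)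
      ((continuous_coord i).comp G.continuous) (hψ i j) fun x _ =>
        (abs_sub_coord_le_dist _ _ i).trans (hd1 x)
  change _ ≤ Var G unitSq at hmem
  refine ⟨⟨hG.isHomeoOn, hG.extendsToId, ⟨?_, hGb⟩, ?_⟩, ?_⟩
  · exact (G.continuous.continuousOn.integrableOn_compact
      (Metric.isCompact_of_isClosed_isBounded isClosed_closure isBounded_unitSq.closure)).mono_set
      subset_closure
  · change Var G unitSq < M
    linarith [sub_pos.2 hM]
  · have hdist : dist (Var G unitSq) v₀ < δ := by
      rw [Real.dist_eq, abs_lt]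
      constructor <;> linarith
    have h3 := hδc hdist
    rw [dist_comm, Real.dist_eq] at h3
    have h4 : supDist p.1 G unitSq ≤ η := supDist_le hη0.le fun x hx => by rw [h1 hx]; exact hd1 x
    have h5 : supDist p.2 G.symm unitSq ≤ η :=
      supDist_le hη0.le fun x hx => by rw [h2 hx]; exact hd2 x
    unfold dX
    change supDist p.1 G unitSq + supDist p.2 G.symm unitSq +
      |1 / (M - v₀) - 1 / (M - Var G unitSq)| < ε
    linarith

theorem abs_linePt_sub_le (j i : Fin 2) (s t t' : ℝ) :
    |linePt j s t i - linePt j s t' i| ≤ 1 * |t - t'| := by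
  rw [one_mul]
  fin_cases j <;> fin_cases i <;> simp [linePt]

/-- Along a segment outside the square the coordinate functions vary as the identity. -/
theorem FixOff.eVariationOn_le_of_off {G : Plane ≃ₜ Plane} (hG : FixOff G) (i j : Fin 2)
    {s a b : ℝ} (hab : a ≤ b) (h : ∀ t ∈ Icc a b, linePt j s t ∉ unitSq) :
    eVariationOn (fun t => G (linePt j s t) i) (Icc a b) ≤ ENNReal.ofReal (b - a) := by
  have := eVariationOn_le_of_lipschitz (f := fun t => G (linePt j s t) i) hab zero_le_one
    fun x hx y hy => by
      rw [hG _ (h x hx), hG _ (h y hy)]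
      exact abs_linePt_sub_le j i s x y
  rwa [one_mul] at this

theorem FixOff.eVariationOn_le_outer {G : Plane ≃ₜ Plane} (hG : FixOff G) (i j : Fin 2)
    (s : ℝ) {δ : ℝ} (hδ : 0 ≤ δ) :
    eVariationOn (fun t => G (linePt j s t) i) (Icc (-δ) (1 + δ)) ≤
      eVariationOn (fun t => G (linePt j s t) i) (Icc 0 1) + ENNReal.ofReal (2 * δ) := by
  set f := fun t => G (linePt j s t) i
  have h1 : eVariationOn f (Icc (-δ) 0) ≤ ENNReal.ofReal δ := by
    have := hG.eVariationOn_le_of_off i j (s := s) (a := -δ) (b := 0) (by linarith) fun t ht hx =>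
      absurd (linePt_mem_unitSq.1 hx).2.1 (not_lt.2 ht.2)
    simpa using this
  have h2 : eVariationOn f (Icc 1 (1 + δ)) ≤ ENNReal.ofReal δ := by
    have := hG.eVariationOn_le_of_off i j (s := s) (a := 1) (b := 1 + δ) (by linarith)
      fun t ht hx => absurd (linePt_mem_unitSq.1 hx).2.2 (not_lt.2 ht.1)
    simpa using this
  have e1 := eVariationOn.Icc_add_Icc f (s := univ) (show -δ ≤ 0 by linarith)
    (show (0 : ℝ) ≤ 1 + δ by linarith) (mem_univ _)
  have e2 := eVariationOn.Icc_add_Icc f (s := univ) (show (0 : ℝ) ≤ 1 by norm_num)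
    (show (1 : ℝ) ≤ 1 + δ by linarith) (mem_univ _)
  simp only [univ_inter] at e1 e2
  rw [← e1, ← e2, two_mul, ENNReal.ofReal_add hδ hδ]
  calc _ ≤ ENNReal.ofReal δ + (eVariationOn f (Icc 0 1) + ENNReal.ofReal δ) := by gcongr
    _ = _ := by ring

theorem lintegral_comp_affine_le {f : ℝ → ℝ≥0∞} (hf : Measurable f) {l δ : ℝ} (hl : 1 ≤ l) :
    ∫⁻ s, f (l * s - δ) ≤ ∫⁻ s, f s := by
  have h1 : ∫⁻ s, f (l * s - δ) = ∫⁻ s, f (s - δ) ∂(Measure.map (l * ·) volume) :=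
    (lintegral_map (hf.comp (measurable_id.sub_const δ)) (measurable_const_mul l)).symm
  rw [h1, Real.map_volume_mul_left (by positivity), lintegral_smul_measure,
    lintegral_sub_right_eq_self]
  refine mul_le_of_le_one_left' ?_
  rw [abs_of_pos (by positivity)]
  exact ENNReal.ofReal_le_one.2 (inv_le_one_of_one_le₀ hl)

/-- The dilation of the plane about the centre of the unit square. -/
def dilation (δ : ℝ) (hδ : 0 < δ) : Plane ≃ₜ Plane :=
  (Homeomorph.smulOfNeZero (1 + 2 * δ) (by positivity)).trans
    (Homeomorph.addRight (-(δ • (!₂[1, 1] : Plane))))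

theorem dilation_apply {δ : ℝ} (hδ : 0 < δ) (x : Plane) (i : Fin 2) :
    dilation δ hδ x i = (1 + 2 * δ) * x i - δ := by
  fin_cases i <;> simp [dilation, sub_eq_add_neg]

theorem dilation_symm_apply {δ : ℝ} (hδ : 0 < δ) (x : Plane) (i : Fin 2) :
    (dilation δ hδ).symm x i = (x i + δ) / (1 + 2 * δ) := by
  have h := dilation_apply hδ ((dilation δ hδ).symm x) i
  rw [Homeomorph.apply_symm_apply] at h
  rw [eq_div_iff (by positivity)]
  linarith

theorem dilation_linePt {δ : ℝ} (hδ : 0 < δ) (j : Fin 2) (s t : ℝ) :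
    dilation δ hδ (linePt j s t) = linePt j ((1 + 2 * δ) * s - δ) ((1 + 2 * δ) * t - δ) := by
  fin_cases j <;> refine plane_ext ?_ ?_ <;> rw [dilation_apply] <;> simp [linePt]

theorem dist_le_abs_add_abs (x y : Plane) : dist x y ≤ |x 0 - y 0| + |x 1 - y 1| := by
  rw [dist_eq_norm]; exact norm_le_abs_add_abs (x - y)

theorem dist_dilation_le {δ : ℝ} (hδ : 0 < δ) {x : Plane} (hx : x ∈ unitSq) :
    dist x (dilation δ hδ x) ≤ 2 * δ := by
  refine (dist_le_abs_add_abs _ _).trans ?_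
  rw [dilation_apply, dilation_apply]
  have h : ∀ a : ℝ, 0 < a → a < 1 → |a - ((1 + 2 * δ) * a - δ)| ≤ δ := fun a h0 h1 => by
    rw [abs_le]; constructor <;> nlinarith
  linarith [h _ hx.1 hx.2.1, h _ hx.2.2.1 hx.2.2.2]

theorem dist_dilation_symm_le {δ : ℝ} (hδ : 0 < δ) {x : Plane} (hx : x ∈ unitSq) :
    dist x ((dilation δ hδ).symm x) ≤ 2 * δ := by
  refine (dist_le_abs_add_abs _ _).trans ?_
  rw [dilation_symm_apply, dilation_symm_apply]
  have h : ∀ a : ℝ, 0 < a → a < 1 → |a - (a + δ) / (1 + 2 * δ)| ≤ δ := fun a h0 h1 => by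
    have : a - (a + δ) / (1 + 2 * δ) = δ * (2 * a - 1) / (1 + 2 * δ) := by field_simp; ring
    rw [this, abs_div, div_le_iff₀ (by positivity), abs_mul, abs_of_pos hδ,
      abs_of_pos (by positivity : 0 < 1 + 2 * δ)]
    have : |2 * a - 1| ≤ 1 := by rw [abs_le]; constructor <;> linarith
    nlinarith
  linarith [h _ hx.1 hx.2.1, h _ hx.2.2.1 hx.2.2.2]

theorem dist_dilation_symm_dilation_symm_le {δ : ℝ} (hδ : 0 < δ) (x y : Plane) :
    dist ((dilation δ hδ).symm x) ((dilation δ hδ).symm y) ≤ dist x y := by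
  have h : (dilation δ hδ).symm x - (dilation δ hδ).symm y = (1 + 2 * δ)⁻¹ • (x - y) := by
    refine plane_ext ?_ ?_ <;>
    · simp only [PiLp.sub_apply, PiLp.smul_apply, dilation_symm_apply, smul_eq_mul]
      field_simp
      ring
  rw [dist_eq_norm, dist_eq_norm, h, norm_smul]
  refine mul_le_of_le_one_left (norm_nonneg _) ?_
  rw [Real.norm_of_nonneg (by positivity)]
  exact inv_le_one_of_one_le₀ (by linarith)

/-- Conjugating by a dilation to create a collar where the map is the identity. -/
def collar (G : Plane ≃ₜ Plane) (δ : ℝ) (hδ : 0 < δ) : Plane ≃ₜ Plane :=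
  ((dilation δ hδ).trans G).trans (dilation δ hδ).symm

theorem collar_apply (G : Plane ≃ₜ Plane) {δ : ℝ} (hδ : 0 < δ) (x : Plane) :
    collar G δ hδ x = (dilation δ hδ).symm (G (dilation δ hδ x)) := rfl

theorem FixOff.collar_eq_self {G : Plane ≃ₜ Plane} (hG : FixOff G) {δ : ℝ} (hδ : 0 < δ) {x : Plane}
    (hx : ∃ i, x i ≤ δ / (1 + 2 * δ) ∨ 1 - δ / (1 + 2 * δ) ≤ x i) : collar G δ hδ x = x := by
  rw [collar_apply, Homeomorph.symm_apply_eq]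
  refine hG _ fun hm => ?_
  obtain ⟨i, hi⟩ := hx
  have hp : 0 < 1 + 2 * δ := by positivity
  have hi' : dilation δ hδ x i ≤ 0 ∨ 1 ≤ dilation δ hδ x i := by
    rw [dilation_apply]
    refine hi.imp (fun h => ?_) fun h => ?_
    · rw [le_div_iff₀ hp] at h; linarith
    · have h' : 1 - x i ≤ δ / (1 + 2 * δ) := by linarith
      rw [le_div_iff₀ hp] at h'; linarith
  obtain ⟨a, b, c, d⟩ := hm
  fin_cases i
  · rcases hi' with h | h
    · exact absurd a (not_lt.2 h)
    · exact absurd b (not_lt.2 h)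
  · rcases hi' with h | h
    · exact absurd c (not_lt.2 h)
    · exact absurd d (not_lt.2 h)

theorem exists_coord_of_notMem_unitSq {x : Plane} (hx : x ∉ unitSq) :
    ∃ i, x i ≤ 0 ∨ 1 ≤ x i := by
  by_contra! h
  exact hx ⟨(h 0).1, (h 0).2, (h 1).1, (h 1).2⟩

theorem FixOff.collar {G : Plane ≃ₜ Plane} (hG : FixOff G) {δ : ℝ} (hδ : 0 < δ) :
    FixOff (collar G δ hδ) := fun x hx => by
  obtain ⟨i, hi⟩ := exists_coord_of_notMem_unitSq hx
  have : 0 < δ / (1 + 2 * δ) := by positivity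
  exact hG.collar_eq_self hδ ⟨i, hi.imp (fun h => by linarith) fun h => by linarith⟩

theorem FixOff.exists_dist_collar_le {G : Plane ≃ₜ Plane} (hG : FixOff G) {η : ℝ} (hη : 0 < η) :
    ∃ δ₀ > 0, ∀ δ (hδ : 0 < δ), δ < δ₀ → ∀ x, dist (G x) (_root_.collar G δ hδ x) ≤ η := by
  obtain ⟨ω, hω, hu⟩ := Metric.uniformContinuous_iff.1 hG.uniformContinuous (η / 2) (by positivity)
  refine ⟨min (ω / 2) (η / 4), lt_min (by positivity) (by positivity), fun δ hδ hlt x => ?_⟩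
  have h1 : δ < ω / 2 := hlt.trans_le (min_le_left _ _)
  have h2 : δ < η / 4 := hlt.trans_le (min_le_right _ _)
  by_cases hx : x ∈ unitSq
  · have h3 := dist_dilation_symm_le hδ (hG.mapsTo hx)
    have h4 := dist_dilation_symm_dilation_symm_le hδ (G x) (G (dilation δ hδ x))
    have h5 := hu ((dist_dilation_le hδ hx).trans_lt (by linarith))
    have h6 := dist_triangle (G x) ((dilation δ hδ).symm (G x)) (_root_.collar G δ hδ x)
    rw [collar_apply] at h6 ⊢
    linarith
  · rw [hG x hx, hG.collar hδ x hx, dist_self]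
    exact hη.le

theorem FixOff.lineVar_collar_le {G : Plane ≃ₜ Plane} (hG : FixOff G) {δ : ℝ} (hδ : 0 < δ)
    {i j : Fin 2} {W : ℝ → ℝ≥0∞} (hW : Measurable W)
    (hV : ∀ s ∈ Ioo (0 : ℝ) 1, eVariationOn (fun t => G (linePt j s t) i) (Icc 0 1) ≤ W s) :
    lineVar (fun x => _root_.collar G δ hδ x i) j ≤
      (∫⁻ s in Ioo (0 : ℝ) 1, W s) + ENNReal.ofReal (4 * δ) := by
  set l := 1 + 2 * δ with hl
  have hl1 : 1 ≤ l := by linarith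
  let R : Set ℝ := Icc (-δ) 0 ∪ Icc 1 (1 + δ)
  have hR : MeasurableSet R := measurableSet_Icc.union measurableSet_Icc
  let B : ℝ → ℝ≥0∞ := fun s => (Ioo (0 : ℝ) 1).indicator W s + R.indicator 1 s
  have hB : Measurable B := (hW.indicator measurableSet_Ioo).add (measurable_one.indicator hR)
  have hline : ∀ s ∈ Ioo (0 : ℝ) 1,
      eVariationOn (fun t => _root_.collar G δ hδ (linePt j s t) i) (Icc 0 1) ≤
        B (l * s - δ) + ENNReal.ofReal (2 * δ) := by
    intro s hs
    set s' := l * s - δ with hs'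
    have hs1 : -δ < s' := by
      have : 0 < l * s := mul_pos (by linarith) hs.1
      linarith
    have hs2 : s' < 1 + δ := by
      have : l * s < l := mul_lt_of_lt_one_right (by linarith) hs.2
      linarith
    have e1 : eVariationOn (fun t => _root_.collar G δ hδ (linePt j s t) i) (Icc 0 1) ≤
        eVariationOn ((fun t => G (linePt j s' t) i) ∘ fun t => l * t - δ) (Icc 0 1) := by
      refine eVariationOn_mono_of_edist fun x _ y _ _ => ?_
      rw [edist_dist, edist_dist]
      refine ENNReal.ofReal_le_ofReal ?_
      simp only [collar_apply, dilation_symm_apply, dilation_linePt, Function.comp, ← hl, ← hs']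
      rw [Real.dist_eq, Real.dist_eq, ← sub_div, abs_div, abs_of_pos (by linarith : 0 < l),
        add_sub_add_right_eq_sub]
      exact div_le_self (abs_nonneg _) hl1
    have e2 : eVariationOn ((fun t => G (linePt j s' t) i) ∘ fun t => l * t - δ) (Icc 0 1) ≤
        eVariationOn (fun t => G (linePt j s' t) i) (Icc (-δ) (1 + δ)) := by
      refine eVariationOn.comp_le_of_monotoneOn _ _ (fun x _ y _ hxy => ?_) fun t ht => ?_
      · have := mul_le_mul_of_nonneg_left hxy (by linarith : 0 ≤ l)
        simpa using this
      · have h1 := mul_le_mul_of_nonneg_left ht.1 (by linarith : 0 ≤ l)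
        have h2 := mul_le_mul_of_nonneg_left ht.2 (by linarith : 0 ≤ l)
        constructor <;> linarith
    refine e1.trans (e2.trans ((hG.eVariationOn_le_outer i j s' hδ.le).trans ?_))
    gcongr
    by_cases hmem : s' ∈ Ioo (0 : ℝ) 1
    · refine (hV s' hmem).trans ?_
      simp only [B, indicator_of_mem hmem]
      exact le_self_add
    · have h1 := hG.eVariationOn_le_of_off i j (s := s') zero_le_one fun t _ hx =>
        hmem (linePt_mem_unitSq.1 hx).1
      refine h1.trans ?_
      have hsR : s' ∈ R := by
        rw [mem_Ioo, not_and_or, not_lt, not_lt] at hmem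
        exact hmem.imp (fun h => ⟨hs1.le, h⟩) fun h => ⟨h, hs2.le⟩
      simp only [B, indicator_of_mem hsR]
      simp
  have hRv : volume R ≤ ENNReal.ofReal (2 * δ) := by
    refine (measure_union_le _ _).trans ?_
    rw [Real.volume_Icc, Real.volume_Icc, two_mul, ENNReal.ofReal_add hδ.le hδ.le]
    simp
  calc lineVar (fun x => _root_.collar G δ hδ x i) j
      ≤ ∫⁻ s in Ioo (0 : ℝ) 1, (B (l * s - δ) + ENNReal.ofReal (2 * δ)) :=
        setLIntegral_mono' measurableSet_Ioo hline
    _ = (∫⁻ s in Ioo (0 : ℝ) 1, B (l * s - δ)) + ENNReal.ofReal (2 * δ) := by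
        rw [lintegral_add_right _ measurable_const]
        simp
    _ ≤ (∫⁻ s, B s) + ENNReal.ofReal (2 * δ) := by
        refine add_le_add_left ?_ _
        exact (setLIntegral_le_lintegral _ _).trans (lintegral_comp_affine_le hB hl1)
    _ ≤ ((∫⁻ s in Ioo (0 : ℝ) 1, W s) + ENNReal.ofReal (2 * δ)) + ENNReal.ofReal (2 * δ) := by
        gcongr
        rw [lintegral_add_left (hW.indicator measurableSet_Ioo),
          lintegral_indicator measurableSet_Ioo, lintegral_indicator_one hR]
        gcongr
    _ = _ := by
        rw [add_assoc, ← ENNReal.ofReal_add (by positivity) (by positivity)]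
        ring_nf

/-- Measurable bounds for the variations along lines, with total integral at most `Var`. -/
theorem exists_line_bounds {G : Plane → Plane} (hG : Continuous G)
    (hb : BddAbove (varSet G unitSq)) : ∃ W : Fin 2 → Fin 2 → ℝ → ℝ≥0∞,
      (∀ i j, Measurable (W i j)) ∧
      (∀ i j, ∀ s ∈ Ioo (0 : ℝ) 1, eVariationOn (fun t => G (linePt j s t) i) (Icc 0 1) ≤ W i j s) ∧
      ∑ i, ∑ j, ∫⁻ s in Ioo (0 : ℝ) 1, W i j s ≤ ENNReal.ofReal (Var G unitSq) := by
  obtain ⟨D, hD0, hD, hDV⟩ := exists_directional_bounds hG hb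
  have : ∀ i j, _ := fun i j =>
    exists_measurable_line_bound ((continuous_coord i).comp hG) (hD i j)
  choose W hW1 hW2 hW3 using this
  refine ⟨W, hW1, hW2, ?_⟩
  refine le_trans ?_ (ENNReal.ofReal_le_ofReal hDV)
  rw [ENNReal.ofReal_sum_of_nonneg fun i _ => Finset.sum_nonneg fun j _ => hD0 i j]
  refine Finset.sum_le_sum fun i _ => ?_
  rw [ENNReal.ofReal_sum_of_nonneg fun j _ => hD0 i j]
  exact Finset.sum_le_sum fun j _ => hW3 i j

theorem FixOff.exists_collar {G : Plane ≃ₜ Plane} (hG : FixOff G)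
    (hb : BddAbove (varSet G unitSq)) {η r₀ : ℝ} (hη : 0 < η) (hr₀ : 0 < r₀) :
    ∃ r, 0 < r ∧ r < r₀ ∧ ∃ G₁ : Plane ≃ₜ Plane, FixOff G₁ ∧
      (∀ x : Plane, (∃ i, x i ≤ r ∨ 1 - r ≤ x i) → G₁ x = x) ∧
      (∀ x, dist (G x) (G₁ x) ≤ η) ∧ (∀ x, dist (G.symm x) (G₁.symm x) ≤ η) ∧
      ∑ i, ∑ j, lineVar (fun x => G₁ x i) j ≤ ENNReal.ofReal (Var G unitSq + η) := by
  obtain ⟨W, hW1, hW2, hW3⟩ := exists_line_bounds G.continuous hb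
  obtain ⟨δ₁, hδ₁, h1⟩ := hG.exists_dist_collar_le hη
  obtain ⟨δ₂, hδ₂, h2⟩ := hG.symm.exists_dist_collar_le hη
  set δ := min (min (δ₁ / 2) (δ₂ / 2)) (min (r₀ / 2) (η / 16)) with hδdef
  have hδ : 0 < δ := by
    refine lt_min (lt_min ?_ ?_) (lt_min ?_ ?_) <;> positivity
  have hd1 : δ ≤ δ₁ / 2 := (min_le_left _ _).trans (min_le_left _ _)
  have hd2 : δ ≤ δ₂ / 2 := (min_le_left _ _).trans (min_le_right _ _)
  have hd3 : δ ≤ r₀ / 2 := (min_le_right _ _).trans (min_le_left _ _)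
  have hd4 : δ ≤ η / 16 := (min_le_right _ _).trans (min_le_right _ _)
  have hr : δ / (1 + 2 * δ) ≤ δ := div_le_self hδ.le (by linarith)
  refine ⟨δ / (1 + 2 * δ), by positivity, by linarith, _root_.collar G δ hδ, hG.collar hδ,
    fun x hx => hG.collar_eq_self hδ hx, h1 δ hδ (by linarith), h2 δ hδ (by linarith), ?_⟩
  calc ∑ i, ∑ j, lineVar (fun x => _root_.collar G δ hδ x i) j
      ≤ ∑ i, ∑ j, ((∫⁻ s in Ioo (0 : ℝ) 1, W i j s) + ENNReal.ofReal (4 * δ)) :=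
        Finset.sum_le_sum fun i _ => Finset.sum_le_sum fun j _ =>
          hG.lineVar_collar_le hδ (hW1 i j) (hW2 i j)
    _ = (∑ i, ∑ j, ∫⁻ s in Ioo (0 : ℝ) 1, W i j s) + ENNReal.ofReal (16 * δ) := by
        rw [show 16 * δ = 4 * δ + 4 * δ + (4 * δ + 4 * δ) by ring]
        rw [ENNReal.ofReal_add (by positivity) (by positivity),
          ENNReal.ofReal_add (p := 4 * δ) (by positivity) (by positivity)]
        simp only [Fin.sum_univ_two]
        ring
    _ ≤ ENNReal.ofReal (Var G unitSq) + ENNReal.ofReal η := by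
        gcongr
        linarith
    _ = _ := (ENNReal.ofReal_add (var_nonneg hb) hη.le).symm

/-- A primitive of a bounded density with positive lower bound, whose inverse transports
Lebesgue measure to the density. -/
theorem exists_orderIso_of_density {ρ : ℝ → ℝ} (hm : Measurable ρ) {c C : ℝ} (hc : 0 < c)
    (h1 : ∀ s, c ≤ ρ s) (h2 : ∀ s, ρ s ≤ C) :
    ∃ p : ℝ ≃o ℝ, (∀ s, p s = ∫ x in (0 : ℝ)..s, ρ x) ∧
      Measure.map p.symm volume = volume.withDensity fun s => ENNReal.ofReal (ρ s) := by
  have hb : ∀ s, ‖ρ s‖ ≤ C := fun s => by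
    rw [Real.norm_of_nonneg (hc.le.trans (h1 s))]; exact h2 s
  have hint : ∀ a b : ℝ, IntervalIntegrable ρ volume a b := fun a b => by
    rw [intervalIntegrable_iff]
    exact Measure.integrableOn_of_bounded (M := C) (by simp) hm.aestronglyMeasurable
      (Eventually.of_forall hb)
  set P : ℝ → ℝ := fun s => ∫ x in (0 : ℝ)..s, ρ x with hP
  have hsub : ∀ a b, P b - P a = ∫ x in a..b, ρ x := fun a b =>
    intervalIntegral.integral_interval_sub_left (hint _ _) (hint _ _)
  have hlow : ∀ a b, a ≤ b → c * (b - a) ≤ P b - P a := fun a b hab => by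
    rw [hsub]
    have := intervalIntegral.integral_mono_on hab (intervalIntegrable_const (c := c)) (hint a b)
      fun x _ => h1 x
    simpa [mul_comm] using this
  have hmono : StrictMono P := fun a b hab => by
    have := hlow a b hab.le
    have h3 : 0 < c * (b - a) := mul_pos hc (sub_pos.2 hab)
    linarith
  have hP0 : P 0 = 0 := by simp [hP]
  have hcont : Continuous P := intervalIntegral.continuous_primitive hint 0
  have hsurj : Function.Surjective P := by
    refine hcont.surjective ?_ ?_
    · refine tendsto_atTop_mono' atTop (f₁ := fun s => c * s) ?_ (tendsto_id.const_mul_atTop hc)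
      filter_upwards [eventually_ge_atTop 0] with s hs
      have := hlow 0 s hs
      linarith
    · refine tendsto_atBot_mono' atBot (?_ : P ≤ᶠ[atBot] fun s => c * s) (tendsto_id.const_mul_atBot hc)
      filter_upwards [eventually_le_atBot 0] with s hs
      have := hlow s 0 hs
      linarith
  set p := hmono.orderIsoOfSurjective P hsurj with hp
  have hpP : ∀ s, p s = P s := fun s => rfl
  refine ⟨p, hpP, ?_⟩
  have hmeas : Measurable p.symm := p.symm.toHomeomorph.continuous.measurable
  have key : ∀ a b : ℝ, a ≤ b → Measure.map p.symm volume (Ioo a b) =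
      (volume.withDensity fun s => ENNReal.ofReal (ρ s)) (Ioo a b) := fun a b hab => by
    rw [Measure.map_apply hmeas measurableSet_Ioo, withDensity_apply _ measurableSet_Ioo]
    have e1 : p.symm ⁻¹' Ioo a b = Ioo (P a) (P b) := by
      rw [OrderIso.preimage_Ioo]; rfl
    rw [e1, Real.volume_Ioo, hsub, intervalIntegral.integral_of_le hab,
      integral_Ioc_eq_integral_Ioo, ofReal_integral_eq_lintegral_ofReal]
    · exact ((intervalIntegrable_iff_integrableOn_Ioo_of_le hab).1 (hint a b))
    · exact Eventually.of_forall fun s => hc.le.trans (h1 s)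
  have : IsLocallyFiniteMeasure (Measure.map p.symm (volume : Measure ℝ)) := by
    refine ⟨fun x => ⟨Ioo (x - 1) (x + 1), Ioo_mem_nhds (by linarith) (by linarith), ?_⟩⟩
    rw [Measure.map_apply hmeas measurableSet_Ioo, OrderIso.preimage_Ioo, Real.volume_Ioo]
    exact ENNReal.ofReal_lt_top
  refine Real.measure_ext_Ioo_rat fun a b => ?_
  rcases le_total (a : ℝ) b with hab | hab
  · exact key a b hab
  · rw [Ioo_eq_empty (not_lt.2 hab)]; simp

/-- A change of variables of the interval squeezing almost all of it into a closed set `S` of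
small `ν`-measure. -/
theorem exists_squeeze (ν : Measure ℝ) {N m : ℕ} (hN : 0 < N) (hm : 0 < m)
    {δ : ℝ} (hδ : 0 < δ) (hδ1 : δ < 1) :
    ∃ (h : ℝ ≃o ℝ) (S : Set ℝ), IsClosed S ∧ S ⊆ Ioc 0 1 ∧ (∀ s ∉ Ioo (0 : ℝ) 1, h s = s) ∧
      (∀ s, |h s - s| ≤ 1 / N) ∧ m * ν S ≤ ν (Ioc 0 1) ∧
      ∀ f : ℝ → ℝ≥0∞, Measurable f → ∫⁻ s in Ioo (0 : ℝ) 1, f (h s) ≤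
        ENNReal.ofReal δ * (∫⁻ s in Ioo (0 : ℝ) 1, f s) + m * ∫⁻ s in S, f s := by
  have hN' : (0 : ℝ) < N := Nat.cast_pos.2 hN
  have hm' : (0 : ℝ) < m := Nat.cast_pos.2 hm
  set w : ℝ := 1 / (N * m) with hw
  have hw0 : 0 < w := by positivity
  let t : ℕ → ℝ := fun n => n * w
  have htm : Monotone t := fun a b hab => by
    have : (a : ℝ) ≤ b := Nat.cast_le.2 hab
    simp only [t]; gcongr
  let T : ℕ → ℝ := fun k => k / N
  have hTm : Monotone T := fun a b hab => by
    have : (a : ℝ) ≤ b := Nat.cast_le.2 hab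
    simp only [T]; gcongr
  have htT : ∀ k, t (k * m) = T k := fun k => by
    simp only [t, T, hw]; push_cast; field_simp
  have hts : ∀ n, t (n + 1) = t n + w := fun n => by simp only [t]; push_cast; ring
  let J : ℕ → Set ℝ := fun n => Ioc (t n) (t (n + 1))
  let I : ℕ → Set ℝ := fun k => Ioc (T k) (T (k + 1))
  let C : ℕ → Set ℝ := fun n => Icc (t n + δ * w) (t (n + 1))
  have hCJ : ∀ n, C n ⊆ J n := fun n x hx => ⟨by
    have : 0 < δ * w := by positivity
    linarith [hx.1], hx.2⟩
  have hJI : ∀ k, ∀ i < m, J (k * m + i) ⊆ I k := fun k i hi => by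
    refine Ioc_subset_Ioc ?_ ?_
    · rw [← htT]; exact htm (Nat.le_add_right _ _)
    · rw [← htT]; refine htm ?_
      rw [add_mul, one_mul, add_assoc]
      exact Nat.add_le_add_left hi _
  have hJd : Pairwise (Function.onFun Disjoint J) := htm.pairwise_disjoint_on_Ioc_succ
  have hId : Pairwise (Function.onFun Disjoint I) := hTm.pairwise_disjoint_on_Ioc_succ
  have hCm : ∀ n, MeasurableSet (C n) := fun n => measurableSet_Icc
  have hpig : ∀ k, ∃ i < m, m * ν (C (k * m + i)) ≤ ν (I k) := by
    intro k
    obtain ⟨i, hi, hmin⟩ := Finset.exists_min_image (Finset.range m) (fun i => ν (C (k * m + i)))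
      ⟨0, Finset.mem_range.2 hm⟩
    refine ⟨i, Finset.mem_range.1 hi, ?_⟩
    have h1 := Finset.card_nsmul_le_sum (Finset.range m) (fun i => ν (C (k * m + i))) _ hmin
    rw [Finset.card_range, nsmul_eq_mul] at h1
    refine h1.trans ?_
    rw [← measure_biUnion_finset]
    · refine measure_mono (iUnion₂_subset fun i hi => (hCJ _).trans (hJI k i (Finset.mem_range.1 hi)))
    · intro a _ b _ hab
      exact (hJd (by simpa using hab)).mono (hCJ _) (hCJ _)
    · exact fun i _ => hCm _
  choose i hi hνi using hpig
  let c : ℕ → Set ℝ := fun k => C (k * m + i k)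
  have hcI : ∀ k, c k ⊆ I k := fun k => (hCJ _).trans (hJI k _ (hi k))
  have hI01 : ∀ k < N, I k ⊆ Ioc 0 1 := fun k hk => by
    refine Ioc_subset_Ioc (by simp only [T]; positivity) ?_
    simp only [T]
    rw [div_le_one hN']
    exact_mod_cast hk
  set S : Set ℝ := ⋃ k ∈ Finset.range N, c k with hS
  have hSc : IsClosed S := isClosed_biUnion_finset fun k _ => isClosed_Icc
  have hSm : MeasurableSet S := hSc.measurableSet
  have hS01 : S ⊆ Ioc 0 1 :=
    iUnion₂_subset fun k hk => (hcI k).trans (hI01 k (Finset.mem_range.1 hk))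
  have hSI : ∀ k < N, ∀ s ∈ I k, (s ∈ S ↔ s ∈ c k) := fun k hk s hs => by
    constructor
    · intro h
      obtain ⟨k', -, hs'⟩ := mem_iUnion₂.1 h
      by_cases hkk : k' = k
      · rwa [hkk] at hs'
      · exact absurd hs (disjoint_left.1 (hId hkk) (hcI k' hs'))
    · exact fun h => mem_iUnion₂.2 ⟨k, Finset.mem_range.2 hk, h⟩
  let ρ : ℝ → ℝ := fun s => if s ∈ Ioc (0 : ℝ) 1 then δ + m * S.indicator 1 s else 1
  have hρm : Measurable ρ := Measurable.ite measurableSet_Ioc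
    (((measurable_one.indicator hSm).const_mul _).const_add _) measurable_const
  have hρ1 : ∀ s, δ ≤ ρ s := fun s => by
    simp only [ρ]
    split_ifs
    · have : 0 ≤ S.indicator (1 : ℝ → ℝ) s := indicator_nonneg (fun _ _ => zero_le_one) s
      have := mul_nonneg hm'.le this
      linarith
    · exact hδ1.le
  have hρ2 : ∀ s, ρ s ≤ 1 + m := fun s => by
    simp only [ρ]
    split_ifs
    · have : S.indicator (1 : ℝ → ℝ) s ≤ 1 := indicator_le_self' (fun _ _ => zero_le_one) s
      have := mul_le_mul_of_nonneg_left this hm'.le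
      linarith
    · linarith
  obtain ⟨p, hp, hmap⟩ := exists_orderIso_of_density hρm hδ hρ1 hρ2
  have hint : ∀ a b : ℝ, IntervalIntegrable ρ volume a b := fun a b => by
    rw [intervalIntegrable_iff]
    refine Measure.integrableOn_of_bounded (M := 1 + m) (by simp) hρm.aestronglyMeasurable
      (Eventually.of_forall fun s => ?_)
    rw [Real.norm_of_nonneg (hδ.le.trans (hρ1 s))]; exact hρ2 s
  have hpsub : ∀ a b, p b = p a + ∫ x in a..b, ρ x := fun a b => by
    rw [hp, hp, intervalIntegral.integral_add_adjacent_intervals (hint _ _) (hint _ _)]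
  have hcell : ∀ k < N, ∫ x in (T k)..(T (k + 1)), ρ x = T (k + 1) - T k := fun k hk => by
    have hle : T k ≤ T (k + 1) := hTm (Nat.le_succ k)
    rw [intervalIntegral.integral_of_le hle]
    have e1 : ∫ x in Ioc (T k) (T (k + 1)), ρ x =
        ∫ x in Ioc (T k) (T (k + 1)), (δ + m * (c k).indicator 1 x) := by
      refine setIntegral_congr_fun measurableSet_Ioc fun x hx => ?_
      simp only [ρ, if_pos (hI01 k hk hx)]
      congr 2
      by_cases hxc : x ∈ c k
      · rw [indicator_of_mem hxc, indicator_of_mem ((hSI k hk x hx).2 hxc)]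
      · rw [indicator_of_notMem hxc, indicator_of_notMem fun h => hxc ((hSI k hk x hx).1 h)]
    have hi1 : IntegrableOn (fun x => (m : ℝ) * (c k).indicator (1 : ℝ → ℝ) x)
        (Ioc (T k) (T (k + 1))) := by
      refine Integrable.const_mul ?_ _
      exact (integrable_const (1 : ℝ)).indicator (hCm _)
    rw [e1, integral_add (integrable_const _) hi1, integral_const_mul,
      setIntegral_indicator (hCm _), inter_eq_self_of_subset_right (hcI k)]
    simp only [Pi.one_apply, setIntegral_const, smul_eq_mul, mul_one]
    rw [Real.volume_real_Ioc_of_le hle]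
    have hcv : volume.real (c k) = (1 - δ) * w := by
      simp only [c, C]
      rw [Real.volume_real_Icc_of_le, hts]
      · ring
      · rw [hts]; nlinarith
    rw [hcv]
    have : T (k + 1) - T k = m * w := by
      simp only [T, hw]; push_cast; field_simp; ring
    rw [this]
    ring
  have hpT : ∀ k ≤ N, p (T k) = T k := fun k => by
    induction k with
    | zero => intro _; simp [hp, T]
    | succ k ih =>
      intro hk
      rw [hpsub (T k), ih (Nat.le_of_succ_le hk), hcell k hk]
      ring
  have hpoff : ∀ s ∉ Ioo (0 : ℝ) 1, p s = s := by
    intro s hs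
    rw [mem_Ioo, not_and_or, not_lt, not_lt] at hs
    rcases hs with hs | hs
    · rw [hp, intervalIntegral.integral_symm, intervalIntegral.integral_of_le hs,
        setIntegral_congr_fun (g := fun _ => (1 : ℝ)) measurableSet_Ioc]
      · simp [Real.volume_real_Ioc_of_le hs]
      · intro x hx
        have : x ∉ Ioc (0 : ℝ) 1 := fun h => absurd h.1 (not_lt.2 hx.2)
        simp only [ρ, if_neg this]
    · have hT : T N = 1 := div_self hN'.ne'
      have h1 := hpT N le_rfl
      rw [hT] at h1
      rw [hpsub 1, h1, intervalIntegral.integral_of_le hs,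
        setIntegral_congr_fun (g := fun _ => (1 : ℝ)) measurableSet_Ioc]
      · simp [Real.volume_real_Ioc_of_le hs]
      · intro x hx
        have : x ∉ Ioc (0 : ℝ) 1 := fun h => absurd hx.1 (not_lt.2 h.2)
        simp only [ρ, if_neg this]
  have hclose : ∀ s, |s - p s| ≤ 1 / N := by
    intro s
    by_cases hs : s ∈ Ioo (0 : ℝ) 1
    · set k := ⌊s * N⌋₊ with hk
      have hk1 : (k : ℝ) ≤ s * N := Nat.floor_le (mul_nonneg hs.1.le hN'.le)
      have hk2 : s * N < k + 1 := Nat.lt_floor_add_one _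
      have hkN : k < N := by
        have : (k : ℝ) < N := hk1.trans_lt (mul_lt_of_lt_one_left hN' hs.2)
        exact_mod_cast this
      have h1 : T k ≤ s := by simp only [T]; rwa [div_le_iff₀ hN']
      have h2 : s ≤ T (k + 1) := by
        simp only [T]; rw [le_div_iff₀ hN']; push_cast; exact hk2.le
      have h3 : T k ≤ p s := by rw [← hpT k hkN.le]; exact p.monotone h1
      have h4 : p s ≤ T (k + 1) := by rw [← hpT (k + 1) hkN]; exact p.monotone h2
      have h5 : T (k + 1) - T k = 1 / N := by simp only [T]; push_cast; field_simp; ring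
      rw [abs_le]; constructor <;> linarith
    · rw [hpoff s hs, sub_self, abs_zero]; positivity
  have hsymm : ∀ s ∉ Ioo (0 : ℝ) 1, p.symm s = s := fun s hs => by
    rw [OrderIso.symm_apply_eq, hpoff s hs]
  refine ⟨p.symm, S, hSc, hS01, hsymm, fun s => ?_, ?_, fun f hf => ?_⟩
  · have := hclose (p.symm s)
    rwa [OrderIso.apply_symm_apply] at this
  · calc m * ν S ≤ m * ∑ k ∈ Finset.range N, ν (c k) := by
          gcongr; exact measure_biUnion_finset_le _ _
      _ = ∑ k ∈ Finset.range N, m * ν (c k) := Finset.mul_sum _ _ _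
      _ ≤ ∑ k ∈ Finset.range N, ν (I k) := Finset.sum_le_sum fun k _ => hνi k
      _ = ν (⋃ k ∈ Finset.range N, I k) := by
          rw [measure_biUnion_finset (fun a _ b _ hab => hId hab) fun k _ => measurableSet_Ioc]
      _ ≤ ν (Ioc 0 1) :=
          measure_mono (iUnion₂_subset fun k hk => hI01 k (Finset.mem_range.1 hk))
  · have hmeas : Measurable p.symm := p.symm.toHomeomorph.continuous.measurable
    have hpre : p.symm ⁻¹' Ioo 0 1 = Ioo 0 1 := by
      rw [OrderIso.preimage_Ioo]
      simp only [OrderIso.symm_symm]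
      rw [hpoff 0 (by simp), hpoff 1 (by simp)]
    have e1 : ∫⁻ s in Ioo (0 : ℝ) 1, f (p.symm s) =
        ∫⁻ s in Ioo (0 : ℝ) 1, f s ∂(Measure.map p.symm volume) := by
      rw [setLIntegral_map measurableSet_Ioo hf hmeas, hpre]
    rw [e1, hmap, setLIntegral_withDensity_eq_setLIntegral_mul _ hρm.ennreal_ofReal hf
      measurableSet_Ioo]
    calc ∫⁻ s in Ioo (0 : ℝ) 1, ((fun s => ENNReal.ofReal (ρ s)) * f) s
        ≤ ∫⁻ s in Ioo (0 : ℝ) 1, (ENNReal.ofReal δ * f s + m * S.indicator f s) := by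
          refine setLIntegral_mono' measurableSet_Ioo fun s hs => ?_
          simp only [Pi.mul_apply, ρ, if_pos (Ioo_subset_Ioc_self hs)]
          by_cases h : s ∈ S
          · rw [indicator_of_mem h, indicator_of_mem h, Pi.one_apply, mul_one,
              ENNReal.ofReal_add hδ.le hm'.le, ENNReal.ofReal_natCast, add_mul]
          · rw [indicator_of_notMem h, indicator_of_notMem h]; simp
      _ = ENNReal.ofReal δ * (∫⁻ s in Ioo (0 : ℝ) 1, f s) +
            m * ∫⁻ s in Ioo (0 : ℝ) 1, S.indicator f s := by
          rw [lintegral_add_left (hf.const_mul _), lintegral_const_mul _ hf,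
            lintegral_const_mul _ (hf.indicator hSm)]
      _ ≤ _ := by
          refine add_le_add_right (mul_le_mul_right ?_ _) _
          refine (setLIntegral_le_lintegral _ _).trans ?_
          rw [lintegral_indicator hSm]

/-- A cutoff function, equal to `1` on `[r, 1 - r]` and vanishing off `(0, 1)`. -/
def cutoff (r y : ℝ) : ℝ := max 0 (min 1 (min (y / r) ((1 - y) / r)))

theorem continuous_cutoff (r : ℝ) : Continuous (cutoff r) := by
  unfold cutoff
  fun_prop

theorem cutoff_nonneg (r y : ℝ) : 0 ≤ cutoff r y := le_max_left _ _

theorem cutoff_le_one (r y : ℝ) : cutoff r y ≤ 1 := max_le zero_le_one (min_le_left _ _)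

theorem cutoff_eq_one {r y : ℝ} (hr : 0 < r) (h1 : r ≤ y) (h2 : y ≤ 1 - r) : cutoff r y = 1 := by
  unfold cutoff
  rw [min_eq_left, max_eq_right zero_le_one]
  refine le_min ?_ ?_ <;> rw [le_div_iff₀ hr] <;> linarith

theorem cutoff_eq_zero {r y : ℝ} (hr : 0 < r) (h : y ∉ Ioo (0 : ℝ) 1) : cutoff r y = 0 := by
  unfold cutoff
  rw [mem_Ioo, not_and_or, not_lt, not_lt] at h
  refine max_eq_left ((min_le_right _ _).trans ?_)
  rcases h with h | h
  · exact (min_le_left _ _).trans (div_nonpos_of_nonpos_of_nonneg h hr.le)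
  · exact (min_le_right _ _).trans (div_nonpos_of_nonpos_of_nonneg (by linarith) hr.le)

theorem abs_cutoff_sub_le {r : ℝ} (hr : 0 < r) (y z : ℝ) :
    |cutoff r y - cutoff r z| ≤ |y - z| / r := by
  unfold cutoff
  have h0 : 0 ≤ |y - z| / r := by positivity
  refine (abs_max_sub_max_le_max _ _ _ _).trans (max_le (by simpa using h0) ?_)
  refine (abs_min_sub_min_le_max _ _ _ _).trans (max_le (by simpa using h0) ?_)
  refine (abs_min_sub_min_le_max _ _ _ _).trans (max_le ?_ ?_)
  · rw [← sub_div, abs_div, abs_of_pos hr]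
  · rw [← sub_div, abs_div, abs_of_pos hr, show 1 - y - (1 - z) = z - y by ring, abs_sub_comm]

/-- The interpolation between the identity and `h` in the horizontal direction. -/
def shearFun (h : ℝ → ℝ) (r : ℝ) (x : Plane) : Plane :=
  !₂[x 0 + cutoff r (x 1) * (h (x 0) - x 0), x 1]

theorem shearFun_zero (h : ℝ → ℝ) (r : ℝ) (x : Plane) :
    shearFun h r x 0 = x 0 + cutoff r (x 1) * (h (x 0) - x 0) := by simp [shearFun]

theorem shearFun_one (h : ℝ → ℝ) (r : ℝ) (x : Plane) : shearFun h r x 1 = x 1 := by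
  simp [shearFun]

theorem strictMono_interp {h : ℝ → ℝ} (hh : StrictMono h) {c : ℝ} (h0 : 0 ≤ c) (h1 : c ≤ 1) :
    StrictMono fun x => x + c * (h x - x) := by
  intro x y hxy
  have h2 := hh hxy
  change x + c * (h x - x) < y + c * (h y - y)
  rcases h0.eq_or_lt with rfl | h0
  · simpa using hxy
  · nlinarith [mul_pos h0 (sub_pos.2 h2), mul_nonneg (sub_nonneg.2 h1) (sub_pos.2 hxy).le]

theorem exists_shear {h : ℝ ≃o ℝ} (hoff : ∀ s ∉ Ioo (0 : ℝ) 1, h s = s) {r : ℝ} (hr : 0 < r) :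
    ∃ H : Plane ≃ₜ Plane, FixOff H ∧ ∀ x, H x = shearFun h r x := by
  have hcont : Continuous h := h.toHomeomorph.continuous
  have hF : Continuous (shearFun h r) := by
    refine (PiLp.continuous_toLp 2 _).comp (continuous_pi fun i => ?_)
    have h0 := continuous_coord 0
    have h1 := continuous_coord 1
    fin_cases i
    · exact h0.add (((continuous_cutoff r).comp h1).mul ((hcont.comp h0).sub h0))
    · exact h1
  have hfix : ∀ x ∉ unitSq, shearFun h r x = x := by
    intro x hx
    refine plane_ext ?_ (shearFun_one _ _ _)
    rw [shearFun_zero]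
    by_cases hx0 : x 0 ∈ Ioo (0 : ℝ) 1
    · rw [cutoff_eq_zero hr fun hx1 => hx ⟨hx0.1, hx0.2, hx1.1, hx1.2⟩]; ring
    · rw [hoff _ hx0]; ring
  have hinj : Function.Injective (shearFun h r) := by
    intro x y hxy
    have h1 : x 1 = y 1 := by
      have := congrArg (fun z : Plane => z 1) hxy
      simpa only [shearFun_one] using this
    have h0 := congrArg (fun z : Plane => z 0) hxy
    simp only [shearFun_zero, h1] at h0
    exact plane_ext ((strictMono_interp h.strictMono (cutoff_nonneg r (y 1))
      (cutoff_le_one r (y 1))).injective h0) h1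
  have hsurj : Function.Surjective (shearFun h r) := by
    intro y
    have hs : Function.Surjective fun x => x + cutoff r (y 1) * (h x - x) := by
      refine Continuous.surjective (by fun_prop) (tendsto_id.congr' ?_) (tendsto_id.congr' ?_)
      · filter_upwards [eventually_ge_atTop 1] with x hx
        rw [hoff x fun h => absurd h.2 (not_lt.2 hx)]; simp
      · filter_upwards [eventually_le_atBot 0] with x hx
        rw [hoff x fun h => absurd h.1 (not_lt.2 hx)]; simp
    obtain ⟨x, hx⟩ := hs (y 0)
    refine ⟨!₂[x, y 1], plane_ext ?_ ?_⟩
    · rw [shearFun_zero]; simpa using hx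
    · rw [shearFun_one]; simp
  obtain ⟨H, hH⟩ := exists_homeomorph_of_eq_off hF ⟨hinj, hsurj⟩ hfix
  exact ⟨H, fun x hx => by rw [hH, hfix x hx], fun x => by rw [hH]⟩

theorem dist_shearFun_le {h : ℝ → ℝ} {c : ℝ} (hc : ∀ s, |h s - s| ≤ c) (r : ℝ) (x : Plane) :
    dist x (shearFun h r x) ≤ c := by
  refine (dist_le_abs_add_abs _ _).trans ?_
  rw [shearFun_zero, shearFun_one, sub_self, abs_zero, add_zero, sub_add_cancel_left, abs_neg,
    abs_mul, abs_of_nonneg (cutoff_nonneg _ _)]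
  exact (mul_le_of_le_one_left (abs_nonneg _) (cutoff_le_one _ _)).trans (hc _)

/-- Composition with a shear does not increase the variation along rows. -/
theorem eVariationOn_row_shear_le (G : Plane → Plane) {h : ℝ ≃o ℝ} (h0 : h 0 = 0) (h1 : h 1 = 1)
    (r s : ℝ) (i : Fin 2) :
    eVariationOn (fun t => G (shearFun h r (linePt 0 s t)) i) (Icc 0 1) ≤
      eVariationOn (fun t => G (linePt 0 s t) i) (Icc 0 1) := by
  have hm := (strictMono_interp h.strictMono (cutoff_nonneg r s) (cutoff_le_one r s)).monotone
  have e : (fun t => G (shearFun h r (linePt 0 s t)) i) =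
      (fun t => G (linePt 0 s t) i) ∘ fun t => t + cutoff r s * (h t - t) := by
    funext t
    have : shearFun h r (linePt 0 s t) = linePt 0 s (t + cutoff r s * (h t - t)) := by
      refine plane_ext ?_ ?_
      · rw [shearFun_zero]; simp [linePt]
      · rw [shearFun_one]; simp [linePt]
    simp only [Function.comp, this]
  rw [e]
  refine eVariationOn.comp_le_of_monotoneOn _ _ (hm.monotoneOn _) fun t ht => ?_
  have a := hm ht.1
  have b := hm ht.2
  simp only [h0, h1] at a b
  constructor
  · simpa using a
  · simpa using b

/-- Composition with a shear moves the columns, up to a small error, when the map is the identity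
near the horizontal sides. -/
theorem eVariationOn_column_shear_le {G : Plane → Plane} {r : ℝ} (hr : 0 < r)
    (hG : ∀ x : Plane, (∃ i, x i ≤ r ∨ 1 - r ≤ x i) → G x = x) (h : ℝ → ℝ) (s : ℝ) (i : Fin 2) :
    eVariationOn (fun t => G (shearFun h r (linePt 1 s t)) i) (Icc 0 1) ≤
      eVariationOn (fun t => G (linePt 1 (h s) t) i) (Icc 0 1) + ENNReal.ofReal (|h s - s| / r) := by
  let E : ℝ → ℝ := fun t => if i = 0 then (cutoff r t - 1) * (h s - s) else 0
  have e : (fun t => G (shearFun h r (linePt 1 s t)) i) =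
      fun t => G (linePt 1 (h s) t) i + E t := by
    funext t
    have hsh : shearFun h r (linePt 1 s t) = linePt 1 (s + cutoff r t * (h s - s)) t := by
      refine plane_ext ?_ ?_
      · rw [shearFun_zero]; simp [linePt]
      · rw [shearFun_one]; simp [linePt]
    rw [hsh]
    by_cases ht : r ≤ t ∧ t ≤ 1 - r
    · have : E t = 0 := by simp [E, cutoff_eq_one hr ht.1 ht.2]
      rw [this, cutoff_eq_one hr ht.1 ht.2]
      simp
    · have ht' : t ≤ r ∨ 1 - r ≤ t := by
        by_contra! hcon
        exact ht ⟨hcon.1.le, hcon.2.le⟩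
      rw [hG _ ⟨1, by rw [linePt_one_one]; exact ht'⟩, hG _ ⟨1, by rw [linePt_one_one]; exact ht'⟩]
      fin_cases i
      · simp [linePt, E]; ring
      · simp [linePt, E]
  rw [e]
  refine (eVariationOn_add_le _ _ _).trans ?_
  gcongr
  have := eVariationOn_le_of_lipschitz (f := E) (K := |h s - s| / r) zero_le_one (by positivity)
    fun x _ y _ => by
      simp only [E]
      split_ifs
      · rw [← sub_mul, abs_mul, sub_sub_sub_cancel_right]
        calc _ ≤ |x - y| / r * |h s - s| :=
              mul_le_mul_of_nonneg_right (abs_cutoff_sub_le hr x y) (abs_nonneg _)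
          _ = _ := by ring
      · simp only [sub_self, abs_zero]; positivity
  simpa using this

/-- A change of variable of the interval which sends almost all of it into a closed set that is
small for `μ`, and increases the integral of `w` by a small amount only. -/
theorem exists_controlled_squeeze {w : ℝ → ℝ≥0∞} (hw : Measurable w) {V : ℝ} (hV : 0 ≤ V)
    (hwV : ∫⁻ s in Ioo (0 : ℝ) 1, w s ≤ ENNReal.ofReal V) (μ : Measure ℝ) (hμ : μ univ ≤ 1)
    {κ η c : ℝ} (hκ : 0 < κ) (hη : 0 < η) (hc : 0 < c) :
    ∃ (h : ℝ ≃o ℝ) (S : Set ℝ), IsClosed S ∧ (∀ s ∉ Ioo (0 : ℝ) 1, h s = s) ∧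
      (∀ s, |h s - s| ≤ c) ∧ μ S ≤ ENNReal.ofReal κ ∧
      volume (Ioo (0 : ℝ) 1 ∩ h ⁻¹' Sᶜ) ≤ ENNReal.ofReal κ ∧
      ∫⁻ s in Ioo (0 : ℝ) 1, w (h s) ≤ (∫⁻ s in Ioo (0 : ℝ) 1, w s) + ENNReal.ofReal η := by
  set ε := η / 2 with hε
  have hε0 : 0 < ε := by positivity
  set δ := min (1 / 2) (min κ (ε / (V + 1))) with hδ
  have hδ0 : 0 < δ := by positivity
  have hδ1 : δ < 1 := (min_le_left _ _).trans_lt (by norm_num)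
  have hδκ : δ ≤ κ := (min_le_right _ _).trans (min_le_left _ _)
  have hδV : δ * V ≤ ε := by
    have h1 : δ ≤ ε / (V + 1) := (min_le_right _ _).trans (min_le_right _ _)
    rw [le_div_iff₀ (by positivity)] at h1
    nlinarith
  obtain ⟨N, hN⟩ := exists_nat_gt (1 / c)
  obtain ⟨m, hm⟩ := exists_nat_gt ((V + ε) / (ε * κ))
  have hN0 : 0 < N := by exact_mod_cast (show (0 : ℝ) < 1 / c by positivity).trans hN
  have hm0 : 0 < m := by
    exact_mod_cast (show (0 : ℝ) ≤ (V + ε) / (ε * κ) by positivity).trans_lt hm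
  let ν : Measure ℝ := volume.withDensity w + ENNReal.ofReal ε • μ
  obtain ⟨h, S, hS, -, hoff, hclose, hνS, hint⟩ := exists_squeeze ν hN0 hm0 hδ0 hδ1
  have hνA : ∀ A, MeasurableSet A → ν A = (∫⁻ s in A, w s) + ENNReal.ofReal ε * μ A := fun A hA => by
    simp [ν, withDensity_apply _ hA]
  have hν1 : ν (Ioc 0 1) ≤ (∫⁻ s in Ioo (0 : ℝ) 1, w s) + ENNReal.ofReal ε := by
    rw [hνA _ measurableSet_Ioc, setLIntegral_congr Ioo_ae_eq_Ioc.symm]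
    gcongr
    exact mul_le_of_le_one_right' ((measure_mono (subset_univ _)).trans hμ)
  rw [hνA _ hS.measurableSet, mul_add] at hνS
  refine ⟨h, S, hS, hoff, fun s => (hclose s).trans ?_, ?_, ?_, ?_⟩
  · rw [div_le_iff₀ (by positivity)]
    rw [div_lt_iff₀ hc] at hN
    linarith
  · have h1 : ENNReal.ofReal (m * ε) * μ S ≤ ENNReal.ofReal (V + ε) := by
      rw [ENNReal.ofReal_mul (by positivity), ENNReal.ofReal_natCast, mul_assoc,
        ENNReal.ofReal_add hV hε0.le]
      exact (le_add_self.trans hνS).trans (hν1.trans (by gcongr))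
    rw [mul_comm, ← ENNReal.le_div_iff_mul_le (Or.inl (ENNReal.ofReal_pos.2 (by positivity)).ne')
        (Or.inl ENNReal.ofReal_ne_top),
      ← ENNReal.ofReal_div_of_pos (by positivity)] at h1
    refine h1.trans (ENNReal.ofReal_le_ofReal ?_)
    rw [div_le_iff₀ (by positivity)]
    rw [div_lt_iff₀ (by positivity)] at hm
    linarith
  · have h1 := hint (Sᶜ.indicator 1) (measurable_one.indicator hS.measurableSet.compl)
    have h2 : ∫⁻ s in S, Sᶜ.indicator (1 : ℝ → ℝ≥0∞) s = 0 := by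
      rw [setLIntegral_congr_fun hS.measurableSet (g := fun _ => 0)
        fun s hs => indicator_of_notMem (by simpa using hs) _]
      simp
    have h3 : ∫⁻ s in Ioo (0 : ℝ) 1, Sᶜ.indicator (1 : ℝ → ℝ≥0∞) s ≤ 1 := by
      calc _ ≤ ∫⁻ s in Ioo (0 : ℝ) 1, (1 : ℝ≥0∞) :=
            lintegral_mono fun s => indicator_le_self' (fun _ _ => zero_le) s
        _ ≤ 1 := by simp
    have hmeas : MeasurableSet (h ⁻¹' Sᶜ) :=
      h.toHomeomorph.continuous.measurable hS.measurableSet.compl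
    have h4 : volume (Ioo (0 : ℝ) 1 ∩ h ⁻¹' Sᶜ) =
        ∫⁻ s in Ioo (0 : ℝ) 1, Sᶜ.indicator (1 : ℝ → ℝ≥0∞) (h s) := by
      rw [inter_comm, ← Measure.restrict_apply hmeas, ← lintegral_indicator_one hmeas]
      rfl
    rw [h4]
    refine h1.trans ?_
    rw [h2, mul_zero, add_zero]
    exact (mul_le_of_le_one_right' h3).trans (ENNReal.ofReal_le_ofReal hδκ)
  · refine (hint w hw).trans ?_
    calc _ ≤ ENNReal.ofReal ε + ((∫⁻ s in Ioo (0 : ℝ) 1, w s) + ENNReal.ofReal ε) := by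
          gcongr
          · refine (mul_le_mul_right hwV _).trans ?_
            rw [← ENNReal.ofReal_mul hδ0.le]
            exact ENNReal.ofReal_le_ofReal hδV
          · exact (le_self_add.trans hνS).trans hν1
      _ = _ := by
          rw [add_left_comm, ← ENNReal.ofReal_add hε0.le hε0.le, hε, add_halves]

/-- A map which is the identity near the boundary can be perturbed so that a small open set has an
image of almost full measure. -/
theorem FixOff.exists_expanding {G : Plane ≃ₜ Plane} (hG : FixOff G)
    (hb : BddAbove (varSet G unitSq)) {r : ℝ} (hr : 0 < r)
    (hcol : ∀ x : Plane, (∃ i, x i ≤ r ∨ 1 - r ≤ x i) → G x = x) {η κ : ℝ} (hη : 0 < η)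
    (hκ : 0 < κ) :
    ∃ g : Plane ≃ₜ Plane, FixOff g ∧ (∀ x, dist (G x) (g x) ≤ η) ∧
      (∀ x, dist (G.symm x) (g.symm x) ≤ η) ∧
      ∑ i, ∑ j, lineVar (fun x => g x i) j ≤ ENNReal.ofReal (Var G unitSq + η) ∧
      ∃ O ⊆ unitSq, IsOpen O ∧ volume O ≤ ENNReal.ofReal κ ∧
        ENNReal.ofReal (1 - 2 * r - κ) ≤ volume (g '' O) := by
  obtain ⟨W, hW1, hW2, hW3⟩ := exists_line_bounds G.continuous hb
  have hV := var_nonneg hb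
  obtain ⟨c₀, hc₀, huc⟩ := Metric.uniformContinuous_iff.1 hG.uniformContinuous η hη
  set c := min (c₀ / 2) (min η (r * (η / 4))) with hcdef
  have hc : 0 < c := by positivity
  have hcc₀ : c < c₀ := (min_le_left _ _).trans_lt (half_lt_self hc₀)
  have hcη : c ≤ η := (min_le_right _ _).trans (min_le_left _ _)
  have hcr : c / r ≤ η / 4 := by
    rw [div_le_iff₀' hr]
    exact (min_le_right _ _).trans (min_le_right _ _)
  let μ : Measure ℝ := (volume.restrict unitSq).map fun z => G.symm z 0
  have hmeas : Measurable fun z => G.symm z 0 :=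
    ((continuous_coord 0).comp G.symm.continuous).measurable
  have hμ : μ univ ≤ 1 := by
    simp only [μ]
    rw [Measure.map_apply hmeas MeasurableSet.univ, preimage_univ, Measure.restrict_apply_univ,
      volume_unitSq]
  have hWsum : ∫⁻ s in Ioo (0 : ℝ) 1, (W 0 1 s + W 1 1 s) ≤ ENNReal.ofReal (Var G unitSq) := by
    rw [lintegral_add_left (hW1 0 1)]
    refine le_trans ?_ hW3
    simp only [Fin.sum_univ_two]
    exact add_le_add le_add_self le_add_self
  obtain ⟨h, S, hS, hoff, hclose, hμS, hvol, hint⟩ := exists_controlled_squeeze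
    ((hW1 0 1).add (hW1 1 1)) hV hWsum μ hμ hκ (half_pos hη) hc
  have h0 : h 0 = 0 := hoff 0 (by simp)
  have h1 : h 1 = 1 := hoff 1 (by simp)
  have hcont : Continuous h := h.toHomeomorph.continuous
  have hmaps : ∀ s, s ∈ Ioo (0 : ℝ) 1 ↔ h s ∈ Ioo (0 : ℝ) 1 := fun s => by
    rw [mem_Ioo, mem_Ioo, ← h.lt_iff_lt, ← h.lt_iff_lt (x := s), h0, h1]
  obtain ⟨H, hH, hHapp⟩ := exists_shear hoff hr
  have hHdist : ∀ x, dist x (H x) ≤ c := fun x => by rw [hHapp]; exact dist_shearFun_le hclose r x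
  refine ⟨H.trans G, fun x hx => ?_, fun x => ?_, fun x => ?_, ?_, ?_⟩
  · rw [Homeomorph.trans_apply, hH x hx, hG x hx]
  · exact (huc ((hHdist x).trans_lt hcc₀)).le
  · have := hHdist (H.symm (G.symm x))
    rw [H.apply_symm_apply, dist_comm] at this
    exact this.trans hcη
  · have hrow : ∀ i, lineVar (fun x => (H.trans G) x i) 0 ≤ ∫⁻ s in Ioo (0 : ℝ) 1, W i 0 s :=
      fun i => setLIntegral_mono (hW1 i 0) fun s hs => by
        simp only [Homeomorph.trans_apply, hHapp]
        exact (eVariationOn_row_shear_le G h0 h1 r s i).trans (hW2 i 0 s hs)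
    have hcolumn : ∀ i, lineVar (fun x => (H.trans G) x i) 1 ≤
        (∫⁻ s in Ioo (0 : ℝ) 1, W i 1 (h s)) + ENNReal.ofReal (η / 4) := fun i => by
      calc _ ≤ ∫⁻ s in Ioo (0 : ℝ) 1, (W i 1 (h s) + ENNReal.ofReal (η / 4)) := by
            refine setLIntegral_mono (((hW1 i 1).comp hcont.measurable).add measurable_const)
              fun s hs => ?_
            simp only [Homeomorph.trans_apply, hHapp]
            refine (eVariationOn_column_shear_le hr hcol h s i).trans ?_
            refine add_le_add (hW2 i 1 _ ((hmaps s).1 hs)) (ENNReal.ofReal_le_ofReal ?_)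
            exact (div_le_div_of_nonneg_right (hclose s) hr.le).trans hcr
        _ = _ := by
            rw [lintegral_add_right _ measurable_const]
            simp
    have e1 : ∫⁻ s in Ioo (0 : ℝ) 1, (W 0 1 + W 1 1) (h s) =
        (∫⁻ s in Ioo (0 : ℝ) 1, W 0 1 (h s)) + ∫⁻ s in Ioo (0 : ℝ) 1, W 1 1 (h s) :=
      lintegral_add_left ((hW1 0 1).comp hcont.measurable) _
    have e2 : ∫⁻ s in Ioo (0 : ℝ) 1, (W 0 1 + W 1 1) s =
        (∫⁻ s in Ioo (0 : ℝ) 1, W 0 1 s) + ∫⁻ s in Ioo (0 : ℝ) 1, W 1 1 s :=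
      lintegral_add_left (hW1 0 1) _
    have e3 : ENNReal.ofReal (η / 2) + (ENNReal.ofReal (η / 4) + ENNReal.ofReal (η / 4)) =
        ENNReal.ofReal η := by
      rw [← ENNReal.ofReal_add (by positivity) (by positivity),
        ← ENNReal.ofReal_add (by positivity) (by positivity)]
      congr 1; ring
    rw [e1, e2] at hint
    rw [ENNReal.ofReal_add hV hη.le, ← e3]
    simp only [Fin.sum_univ_two] at hW3 ⊢
    calc _ ≤ _ := add_le_add (add_le_add (hrow 0) (hcolumn 0)) (add_le_add (hrow 1) (hcolumn 1))
      _ = (∫⁻ s in Ioo (0 : ℝ) 1, W 0 0 s) + (∫⁻ s in Ioo (0 : ℝ) 1, W 1 0 s) +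
          ((∫⁻ s in Ioo (0 : ℝ) 1, W 0 1 (h s)) + ∫⁻ s in Ioo (0 : ℝ) 1, W 1 1 (h s)) +
          (ENNReal.ofReal (η / 4) + ENNReal.ofReal (η / 4)) := by ring
      _ ≤ (∫⁻ s in Ioo (0 : ℝ) 1, W 0 0 s) + (∫⁻ s in Ioo (0 : ℝ) 1, W 1 0 s) +
          ((∫⁻ s in Ioo (0 : ℝ) 1, W 0 1 s) + (∫⁻ s in Ioo (0 : ℝ) 1, W 1 1 s) +
            ENNReal.ofReal (η / 2)) +
          (ENNReal.ofReal (η / 4) + ENNReal.ofReal (η / 4)) := by gcongr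
      _ = (∫⁻ s in Ioo (0 : ℝ) 1, W 0 0 s) + (∫⁻ s in Ioo (0 : ℝ) 1, W 0 1 s) +
          ((∫⁻ s in Ioo (0 : ℝ) 1, W 1 0 s) + (∫⁻ s in Ioo (0 : ℝ) 1, W 1 1 s)) +
          (ENNReal.ofReal (η / 2) +
            (ENNReal.ofReal (η / 4) + ENNReal.ofReal (η / 4))) := by ring
      _ ≤ _ := by gcongr
  · let O : Set Plane := {x | x 0 ∈ Ioo (0 : ℝ) 1 ∩ h ⁻¹' Sᶜ ∧ x 1 ∈ Ioo r (1 - r)}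
    have hI : IsOpen (Ioo (0 : ℝ) 1 ∩ h ⁻¹' Sᶜ) := isOpen_Ioo.inter (hS.isOpen_compl.preimage hcont)
    have hOopen : IsOpen O :=
      (hI.preimage (continuous_coord 0)).inter (isOpen_Ioo.preimage (continuous_coord 1))
    refine ⟨O, fun x hx => ⟨hx.1.1.1, hx.1.1.2, hr.trans hx.2.1, by linarith [hx.2.2]⟩, hOopen,
      ?_, ?_⟩
    · rw [← (measurePreserving_linePt 1).measure_preimage_emb (measurableEmbedding_linePt 1)]
      have : (fun p : ℝ × ℝ => linePt 1 p.1 p.2) ⁻¹' O =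
          (Ioo (0 : ℝ) 1 ∩ h ⁻¹' Sᶜ) ×ˢ Ioo r (1 - r) := by
        ext p
        simp only [O, mem_preimage, mem_ofPred_eq, linePt_one_zero, linePt_one_one, mem_prod]
      rw [this, Measure.volume_eq_prod, Measure.prod_prod]
      refine (mul_le_of_le_one_right' ?_).trans hvol
      rw [Real.volume_Ioo]
      exact ENNReal.ofReal_le_one.2 (by linarith)
    · set A : Set Plane := {z | 0 < z 0 ∧ z 0 < 1 ∧ r < z 1 ∧ z 1 < 1 - r} with hA
      set B : Set Plane := unitSq ∩ (fun z => G.symm z 0) ⁻¹' S with hB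
      have hsub : A \ B ⊆ H.trans G '' O := by
        rintro z ⟨⟨z1, z2, z3, z4⟩, hzB⟩
        have hzQ : z ∈ unitSq := ⟨z1, z2, hr.trans z3, by linarith⟩
        have hxS : G.symm z 0 ∉ S := fun hzS => hzB ⟨hzQ, hzS⟩
        have hxQ : G.symm z ∈ unitSq := hG.symm.mapsTo hzQ
        have hx1 : r < G.symm z 1 ∧ G.symm z 1 < 1 - r := by
          by_contra hcon
          have h' : G.symm z 1 ≤ r ∨ 1 - r ≤ G.symm z 1 := by
            by_contra! hc'
            exact hcon hc'
          have := hcol _ ⟨1, h'⟩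
          rw [G.apply_symm_apply] at this
          rw [← this] at hcon
          exact hcon ⟨z3, z4⟩
        refine ⟨!₂[h.symm (G.symm z 0), G.symm z 1], ⟨⟨?_, ?_⟩, ?_⟩, ?_⟩
        · rw [hmaps]
          simpa using ⟨hxQ.1, hxQ.2.1⟩
        · simpa using hxS
        · simpa using hx1
        · rw [Homeomorph.trans_apply, ← Homeomorph.eq_symm_apply, hHapp]
          refine plane_ext ?_ ?_
          · rw [shearFun_zero]
            simp [cutoff_eq_one hr hx1.1.le hx1.2.le]
          · rw [shearFun_one]; simp
      have hBvol : volume B ≤ ENNReal.ofReal κ := by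
        refine le_trans (le_of_eq ?_) hμS
        simp only [μ]
        rw [Measure.map_apply hmeas hS.measurableSet,
          Measure.restrict_apply (hmeas hS.measurableSet), inter_comm]
      calc _ = ENNReal.ofReal (1 - 2 * r) - ENNReal.ofReal κ := ENNReal.ofReal_sub _ hκ.le
        _ ≤ volume A - volume B := by
            refine tsub_le_tsub (le_of_eq ?_) hBvol
            rw [hA, volume_rect, sub_zero, ENNReal.ofReal_one, one_mul]
            congr 1; ring
        _ ≤ volume (A \ B) := le_measure_sdiff
        _ ≤ _ := measure_mono hsub

/-- The open right isosceles triangle with vertices `(a, b)`, `(a + σ, b)`, `(a + σ, b + σ)`. -/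
def rightTriangle (a b σ : ℝ) : Set Plane :=
  {x | 0 < (x 1 - b) / σ ∧ (x 1 - b) / σ < (x 0 - a) / σ ∧ (x 0 - a) / σ < 1}

theorem convexHull_rightTriangle (a b : ℝ) {σ : ℝ} (hσ : σ ≠ 0) :
    convexHull ℝ {!₂[a, b], !₂[a + σ, b], !₂[a + σ, b + σ]} =
      {x : Plane | 0 ≤ (x 1 - b) / σ ∧ (x 1 - b) / σ ≤ (x 0 - a) / σ ∧ (x 0 - a) / σ ≤ 1} := by
  refine Subset.antisymm (convexHull_min ?_ ?_) fun x hx => ?_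
  · rintro x (rfl | rfl | rfl) <;> simp [hσ]
  · rintro x ⟨x1, x2, x3⟩ y ⟨y1, y2, y3⟩ s t hs ht hst
    have e0 : ((s • x + t • y : Plane) 0 - a) / σ = s * ((x 0 - a) / σ) + t * ((y 0 - a) / σ) := by
      simp only [PiLp.add_apply, PiLp.smul_apply, smul_eq_mul]
      field_simp
      linear_combination a * hst
    have e1 : ((s • x + t • y : Plane) 1 - b) / σ = s * ((x 1 - b) / σ) + t * ((y 1 - b) / σ) := by
      simp only [PiLp.add_apply, PiLp.smul_apply, smul_eq_mul]
      field_simp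
      linear_combination b * hst
    change 0 ≤ _ ∧ _ ≤ _ ∧ _ ≤ (1 : ℝ)
    rw [e0, e1]
    refine ⟨by positivity, by gcongr, ?_⟩
    nlinarith [mul_le_mul_of_nonneg_left x3 hs, mul_le_mul_of_nonneg_left y3 ht]
  · obtain ⟨h1, h2, h3⟩ := hx
    set Y := (x 1 - b) / σ with hY
    set Z := (x 0 - a) / σ with hZ
    have hx1 : x 1 = b + Y * σ := by rw [hY]; field_simp; ring
    have hx0 : x 0 = a + Z * σ := by rw [hZ]; field_simp; ring
    have hmem : ∀ z ∈ ({!₂[a, b], !₂[a + σ, b], !₂[a + σ, b + σ]} : Set Plane),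
        z ∈ convexHull ℝ ({!₂[a, b], !₂[a + σ, b], !₂[a + σ, b + σ]} : Set Plane) :=
      fun z hz => subset_convexHull _ _ hz
    have hconv := convex_convexHull ℝ ({!₂[a, b], !₂[a + σ, b], !₂[a + σ, b + σ]} : Set Plane)
    have := hconv.sum_mem (t := Finset.univ) (w := ![1 - Z, Z - Y, Y])
      (z := ![!₂[a, b], !₂[a + σ, b], !₂[a + σ, b + σ]])
      (by intro i _; fin_cases i <;> simp <;> linarith)
      (by simp [Fin.sum_univ_three])
      (by intro i _; apply hmem; fin_cases i <;> simp)
    convert this using 1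
    refine plane_ext ?_ ?_
    · simp [Fin.sum_univ_three, hx0]; ring
    · simp [Fin.sum_univ_three, hx1]; ring

theorem continuous_rightTriangle_coord (a σ : ℝ) (i : Fin 2) :
    Continuous fun x : Plane => (x i - a) / σ :=
  ((continuous_coord i).sub continuous_const).div_const _

theorem isOpen_rightTriangle (a b σ : ℝ) : IsOpen (rightTriangle a b σ) :=
  (isOpen_lt continuous_const (continuous_rightTriangle_coord b σ 1)).inter
    ((isOpen_lt (continuous_rightTriangle_coord b σ 1) (continuous_rightTriangle_coord a σ 0)).inter
      (isOpen_lt (continuous_rightTriangle_coord a σ 0) continuous_const))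

theorem isOpenTriangle_rightTriangle (a b : ℝ) {σ : ℝ} (hσ : σ ≠ 0) :
    IsOpenTriangle (rightTriangle a b σ) := by
  refine ⟨!₂[a, b], !₂[a + σ, b], !₂[a + σ, b + σ], ?_⟩
  rw [convexHull_rightTriangle a b hσ]
  refine Subset.antisymm (interior_maximal (fun x hx => ⟨hx.1.le, hx.2.1.le, hx.2.2.le⟩)
    (isOpen_rightTriangle a b σ)) fun x hx => ?_
  have key : ∀ u v : ℝ, ∃ t > 0, 0 ≤ (x 1 - b) / σ + t * v ∧
      (x 1 - b) / σ + t * v ≤ (x 0 - a) / σ + t * u ∧ (x 0 - a) / σ + t * u ≤ 1 := by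
    intro u v
    have hc : Continuous fun t : ℝ => x + t • (!₂[σ * u, σ * v] : Plane) := by fun_prop
    have h0 := hc.tendsto 0
    simp only [zero_smul, add_zero] at h0
    have h1 := (h0.eventually (mem_interior_iff_mem_nhds.1 hx)).filter_mono
      (nhdsWithin_le_nhds (s := Ioi 0))
    obtain ⟨t, ht, ht0⟩ := (h1.and self_mem_nhdsWithin).exists
    refine ⟨t, ht0, ?_⟩
    have e0 : ((x + t • (!₂[σ * u, σ * v] : Plane)) 0 - a) / σ = (x 0 - a) / σ + t * u := by
      simp; field_simp; ring
    have e1 : ((x + t • (!₂[σ * u, σ * v] : Plane)) 1 - b) / σ = (x 1 - b) / σ + t * v := by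
      simp; field_simp; ring
    rw [← e0, ← e1]
    exact ht
  obtain ⟨t, ht, h1, -, -⟩ := key 0 (-1)
  obtain ⟨s, hs, -, h2, -⟩ := key 0 1
  obtain ⟨q, hq, -, -, h3⟩ := key 1 0
  exact ⟨by linarith, by linarith, by linarith⟩

/-- A grid of right isosceles triangles of size `r`. -/
def gridTriangle (a b r : ℝ) (k : ℤ × ℤ × Bool) : Set Plane :=
  if k.2.2 then rightTriangle (a + k.1 * r) (b + k.2.1 * r) r
  else rightTriangle (a + (k.1 + 1) * r) (b + (k.2.1 + 1) * r) (-r)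

theorem mem_gridTriangle_true {a b r : ℝ} (hr : 0 < r) {i j : ℤ} {x : Plane} :
    x ∈ gridTriangle a b r (i, j, true) ↔ 0 < (x 1 - b) / r - j ∧
      (x 1 - b) / r - j < (x 0 - a) / r - i ∧ (x 0 - a) / r - i < 1 := by
  have e0 : (x 0 - (a + i * r)) / r = (x 0 - a) / r - i := by field_simp; ring
  have e1 : (x 1 - (b + j * r)) / r = (x 1 - b) / r - j := by field_simp; ring
  simp only [gridTriangle, if_true, rightTriangle, mem_ofPred_eq, e0, e1]

theorem mem_gridTriangle_false {a b r : ℝ} (hr : 0 < r) {i j : ℤ} {x : Plane} :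
    x ∈ gridTriangle a b r (i, j, false) ↔ 0 < (x 0 - a) / r - i ∧
      (x 0 - a) / r - i < (x 1 - b) / r - j ∧ (x 1 - b) / r - j < 1 := by
  have e0 : (x 0 - (a + (i + 1) * r)) / (-r) = 1 - ((x 0 - a) / r - i) := by field_simp; ring
  have e1 : (x 1 - (b + (j + 1) * r)) / (-r) = 1 - ((x 1 - b) / r - j) := by field_simp; ring
  simp only [gridTriangle, Bool.false_eq_true, if_false, rightTriangle, mem_ofPred_eq, e0, e1]
  constructor <;> rintro ⟨h1, h2, h3⟩ <;> exact ⟨by linarith, by linarith, by linarith⟩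

theorem isOpenTriangle_gridTriangle (a b : ℝ) {r : ℝ} (hr : 0 < r) (k : ℤ × ℤ × Bool) :
    IsOpenTriangle (gridTriangle a b r k) := by
  unfold gridTriangle
  split_ifs
  · exact isOpenTriangle_rightTriangle _ _ hr.ne'
  · exact isOpenTriangle_rightTriangle _ _ (neg_ne_zero.2 hr.ne')

theorem mem_Ioo_of_mem_gridTriangle {a b r : ℝ} (hr : 0 < r) {k : ℤ × ℤ × Bool} {x : Plane}
    (hx : x ∈ gridTriangle a b r k) :
    (x 0 - a) / r - k.1 ∈ Ioo (0 : ℝ) 1 ∧ (x 1 - b) / r - k.2.1 ∈ Ioo (0 : ℝ) 1 := by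
  obtain ⟨i, j, _ | _⟩ := k
  · obtain ⟨h1, h2, h3⟩ := (mem_gridTriangle_false hr).1 hx
    exact ⟨⟨h1, h2.trans h3⟩, h1.trans h2, h3⟩
  · obtain ⟨h1, h2, h3⟩ := (mem_gridTriangle_true hr).1 hx
    exact ⟨⟨h1.trans h2, h3⟩, h1, h2.trans h3⟩

theorem disjoint_gridTriangle (a b : ℝ) {r : ℝ} (hr : 0 < r) {k l : ℤ × ℤ × Bool} (hkl : k ≠ l) :
    Disjoint (gridTriangle a b r k) (gridTriangle a b r l) := by
  rw [Set.disjoint_left]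
  intro x hk hl
  have h1 := mem_Ioo_of_mem_gridTriangle hr hk
  have h2 := mem_Ioo_of_mem_gridTriangle hr hl
  have floor_eq : ∀ {y : ℝ} {i : ℤ}, y - i ∈ Ioo (0 : ℝ) 1 → ⌊y⌋ = i := fun hy =>
    Int.floor_eq_iff.2 ⟨by linarith [hy.1], by linarith [hy.2]⟩
  obtain ⟨i, j, τ⟩ := k
  obtain ⟨i', j', τ'⟩ := l
  obtain rfl : i = i' := (floor_eq h1.1).symm.trans (floor_eq h2.1)
  obtain rfl : j = j' := (floor_eq h1.2).symm.trans (floor_eq h2.2)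
  cases τ <;> cases τ'
  · exact hkl rfl
  · exact absurd ((mem_gridTriangle_false hr).1 hk).2.1
      (not_lt.2 ((mem_gridTriangle_true hr).1 hl).2.1.le)
  · exact absurd ((mem_gridTriangle_false hr).1 hl).2.1
      (not_lt.2 ((mem_gridTriangle_true hr).1 hk).2.1.le)
  · exact hkl rfl

theorem dist_lt_of_mem_gridTriangle {a b r : ℝ} (hr : 0 < r) {k : ℤ × ℤ × Bool} {x y : Plane}
    (hx : x ∈ gridTriangle a b r k) (hy : y ∈ gridTriangle a b r k) : dist x y < 2 * r := by
  have h1 := mem_Ioo_of_mem_gridTriangle hr hx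
  have h2 := mem_Ioo_of_mem_gridTriangle hr hy
  have aux : ∀ {u v c i : ℝ}, (u - c) / r - i ∈ Ioo (0 : ℝ) 1 → (v - c) / r - i ∈ Ioo (0 : ℝ) 1 →
      |u - v| < r := by
    intro u v c i hu hv
    have e : u - v = (((u - c) / r - i) - ((v - c) / r - i)) * r := by field_simp; ring
    rw [e, abs_mul, abs_of_pos hr]
    refine mul_lt_of_lt_one_left hr (abs_lt.2 ⟨?_, ?_⟩) <;> linarith [hu.1, hu.2, hv.1, hv.2]
  have := dist_le_abs_add_abs x y
  linarith [aux h1.1 h2.1, aux h1.2 h2.2]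

theorem exists_mem_gridTriangle {a b r : ℝ} (hr : 0 < r) {x : Plane}
    (h0 : ∀ n : ℤ, x 0 ≠ a + n * r) (h1 : ∀ n : ℤ, x 1 ≠ b + n * r)
    (h2 : ∀ n : ℤ, x 0 - x 1 ≠ a - b + n * r) : ∃ k, x ∈ gridTriangle a b r k := by
  set X := (x 0 - a) / r with hX
  set Y := (x 1 - b) / r with hY
  have hx0 : x 0 = a + X * r := by rw [hX]; field_simp; ring
  have hx1 : x 1 = b + Y * r := by rw [hY]; field_simp; ring
  have hX0 : 0 < X - ⌊X⌋ := by
    refine lt_of_le_of_ne (sub_nonneg.2 (Int.floor_le X)) fun h => h0 ⌊X⌋ ?_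
    rw [hx0, ← sub_eq_zero.1 h.symm]
  have hY0 : 0 < Y - ⌊Y⌋ := by
    refine lt_of_le_of_ne (sub_nonneg.2 (Int.floor_le Y)) fun h => h1 ⌊Y⌋ ?_
    rw [hx1, ← sub_eq_zero.1 h.symm]
  have hX1 : X - ⌊X⌋ < 1 := by linarith [Int.lt_floor_add_one X]
  have hY1 : Y - ⌊Y⌋ < 1 := by linarith [Int.lt_floor_add_one Y]
  rcases lt_trichotomy (X - ⌊X⌋) (Y - ⌊Y⌋) with h | h | h
  · exact ⟨(⌊X⌋, ⌊Y⌋, false), (mem_gridTriangle_false hr).2 ⟨hX0, h, hY1⟩⟩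
  · refine absurd ?_ (h2 (⌊X⌋ - ⌊Y⌋))
    rw [hx0, hx1]
    push_cast
    linear_combination r * h
  · exact ⟨(⌊X⌋, ⌊Y⌋, true), (mem_gridTriangle_true hr).2 ⟨hY0, h, hX1⟩⟩

/-- Almost every offset is such that the corresponding level sets are null. -/
theorem countable_bad_offsets (μ : Measure Plane) [IsFiniteMeasure μ] {u : Plane → ℝ}
    (hu : Continuous u) (c r : ℝ) :
    {a : ℝ | ∃ n : ℤ, μ {x | u x = a + c + n * r} ≠ 0}.Countable := by
  have h := Measure.countable_meas_level_set_pos (μ := μ) hu.measurable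
  have : {a : ℝ | ∃ n : ℤ, μ {x | u x = a + c + n * r} ≠ 0} =
      ⋃ n : ℤ, (fun a : ℝ => a + c + n * r) ⁻¹' {t | 0 < μ {x | u x = t}} := by
    ext a
    simp [pos_iff_ne_zero]
  rw [this]
  exact countable_iUnion fun n => h.preimage fun x y hxy => by
    simpa using hxy

/-- The grid can be translated so that its lines are null sets. -/
theorem exists_grid_ae (μ : Measure Plane) [IsFiniteMeasure μ] {r : ℝ} (hr : 0 < r) :
    ∃ a b : ℝ, ∀ᵐ x ∂μ, ∃ k, x ∈ gridTriangle a b r k := by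
  have c0 := continuous_coord 0
  have c1 := continuous_coord 1
  have ex : ∀ {s : Set ℝ}, s.Countable → ∃ a, a ∉ s := fun hs => (hs.dense_compl ℝ).nonempty
  obtain ⟨a, ha⟩ := ex (countable_bad_offsets μ c0 0 r)
  obtain ⟨b, hb⟩ := ex ((countable_bad_offsets μ c1 0 r).union
    (countable_bad_offsets μ (c1.sub c0) (-a) r))
  refine ⟨a, b, ?_⟩
  simp only [mem_union, mem_ofPred_eq, not_or, not_exists, not_not, add_zero] at ha hb
  have n0 : ∀ᵐ x ∂μ, ∀ n : ℤ, x 0 ≠ a + n * r := ae_all_iff.2 fun n => by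
    simpa [ae_iff] using ha n
  have n1 : ∀ᵐ x ∂μ, ∀ n : ℤ, x 1 ≠ b + n * r := ae_all_iff.2 fun n => by
    simpa [ae_iff] using hb.1 n
  have n2 : ∀ᵐ x ∂μ, ∀ n : ℤ, x 1 - x 0 ≠ b + -a + n * r := ae_all_iff.2 fun n => by
    simpa [ae_iff] using hb.2 n
  filter_upwards [n0, n1, n2] with x h0 h1 h2
  refine exists_mem_gridTriangle hr h0 h1 fun n hn => h2 (-n) ?_
  push_cast
  linarith

theorem finUnionTriangles_biUnion_gridTriangle (a b : ℝ) {r : ℝ} (hr : 0 < r)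
    (s : Finset (ℤ × ℤ × Bool)) : FinUnionTriangles (⋃ k ∈ s, gridTriangle a b r k) := by
  refine ⟨s.card, fun i => gridTriangle a b r (s.equivFin.symm i),
    fun i => isOpenTriangle_gridTriangle a b hr _, fun i j hij => disjoint_gridTriangle a b hr ?_, ?_⟩
  · exact fun h => hij (s.equivFin.symm.injective (Subtype.ext h))
  · rw [s.equivFin.symm.surjective.iUnion_comp fun k : s => gridTriangle a b r k]
    exact biUnion_eq_iUnion _ _

/-- Inner regularity with respect to finite unions of disjoint triangles. -/
theorem exists_finUnionTriangles_subset (μ : Measure Plane) [IsFiniteMeasure μ] {O : Set Plane}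
    (hO : IsOpen O) {c : ℝ≥0∞} (hc : c < μ O) :
    ∃ E ⊆ O, FinUnionTriangles E ∧ c < μ E := by
  let D : ℕ → Set Plane := fun n => {x | Metric.ball x (2 * (1 / ((n : ℝ) + 1))) ⊆ O}
  have hD : Monotone D := fun m n hmn x hx =>
    (Metric.ball_subset_ball (by gcongr)).trans hx
  have hDO : O ⊆ ⋃ n, D n := fun x hx => by
    obtain ⟨δ, hδ, hball⟩ := Metric.isOpen_iff.1 hO x hx
    obtain ⟨n, hn⟩ := exists_nat_one_div_lt (half_pos hδ)
    exact mem_iUnion.2 ⟨n, (Metric.ball_subset_ball (by linarith)).trans hball⟩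
  have h1 := hc.trans_le (measure_mono hDO)
  rw [hD.measure_iUnion, lt_iSup_iff] at h1
  obtain ⟨n, hn⟩ := h1
  set r : ℝ := 1 / ((n : ℝ) + 1) with hr_def
  have hr : 0 < r := by positivity
  obtain ⟨a, b, hab⟩ := exists_grid_ae μ hr
  let K := {k // gridTriangle a b r k ⊆ O}
  have h2 : μ (D n) ≤ μ (⋃ s : Finset K, ⋃ k ∈ s, gridTriangle a b r k) := by
    refine measure_mono_ae ?_
    filter_upwards [hab] with x hx hxD
    obtain ⟨k, hk⟩ := hx
    have hkO : gridTriangle a b r k ⊆ O := fun y hy =>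
      hxD (Metric.mem_ball.2 (dist_lt_of_mem_gridTriangle hr hy hk))
    exact mem_iUnion.2 ⟨{⟨k, hkO⟩}, by simpa using hk⟩
  have hdir : Directed (· ⊆ ·) fun s : Finset K => ⋃ k ∈ s, gridTriangle a b r k :=
    directed_of_isDirected_le fun s t hst => biUnion_subset_biUnion_left hst
  have h3 := hn.trans_le h2
  rw [hdir.measure_iUnion, lt_iSup_iff] at h3
  obtain ⟨s, hs⟩ := h3
  refine ⟨⋃ k ∈ s, gridTriangle a b r k, iUnion₂_subset fun k _ => k.2, ?_, hs⟩
  have := finUnionTriangles_biUnion_gridTriangle a b hr (s.map (Function.Embedding.subtype _))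
  simpa only [← Finset.mem_coe, Finset.coe_map, biUnion_image, Function.Embedding.coe_subtype]
    using this

theorem exists_finUnionTriangles_image (g : Plane ≃ₜ Plane) {O : Set Plane} (hO : IsOpen O)
    (hOQ : O ⊆ unitSq) (hg : FixOff g) {c : ℝ≥0∞} (hc : c < volume (g '' O)) :
    ∃ E ⊆ O, FinUnionTriangles E ∧ c < volume (g '' E) := by
  let μ : Measure Plane := (volume.restrict unitSq).map g.symm
  have : IsFiniteMeasure (volume.restrict unitSq) := ⟨by simp [volume_unitSq]⟩
  have hμ : ∀ E, μ E = volume.restrict unitSq (g '' E) := fun E => by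
    rw [g.image_eq_preimage_symm]
    exact g.symm.measurableEmbedding.map_apply _ _
  have hQ : g '' O ⊆ unitSq := image_subset_iff.2 fun x hx => hg.mapsTo (hOQ hx)
  rw [← Measure.restrict_eq_self volume hQ, ← hμ] at hc
  obtain ⟨E, hEO, hE, hcE⟩ := exists_finUnionTriangles_subset μ hO hc
  exact ⟨E, hEO, hE, hcE.trans_le ((hμ E).trans_le (Measure.restrict_apply_le _ _))⟩

/-- for every `n ≥ 1`, the set `A_n` is dense in the metric space `(X, d)`. -/
theorem An_dense (M : ℝ) (hM : 2 < M) (n : ℕ) (hn : 1 ≤ n) :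
    DenseInX M (An M n) := by
  refine ⟨fun _ h => h.1, fun p hp ε hε => ?_⟩
  obtain ⟨G₀, hG₀, h1, h2⟩ := exists_homeomorph_of_mem_X hp
  obtain ⟨η, hη, hcrit⟩ := exists_close_criterion hp h1 h2 hε
  have hvs : varSet p.1 unitSq = varSet G₀ unitSq := varSet_congr h1
  have hb₀ : BddAbove (varSet G₀ unitSq) := hvs ▸ hp.2.2.1.2
  have hVar : Var p.1 unitSq = Var G₀ unitSq := by rw [Var, Var, hvs]
  have hn0 : (0 : ℝ) < n := by exact_mod_cast hn
  set κ : ℝ := 1 / (4 * n) with hκ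
  have hκ0 : 0 < κ := by positivity
  obtain ⟨r, hr, hrκ, G₁, hG₁, hcol, hd, hds, hlv⟩ := hG₀.exists_collar hb₀ (half_pos hη) hκ0
  obtain ⟨hb₁, hV₁⟩ := var_le_of_lineVar_le G₁.continuous
    (add_nonneg (var_nonneg hb₀) (half_pos hη).le) hlv
  obtain ⟨g, hg, hd', hds', hlv', O, hOQ, hO, hvO, hgO⟩ :=
    hG₁.exists_expanding hb₁ hr hcol (half_pos hη) hκ0
  obtain ⟨hgX, hdist⟩ := hcrit g hg
    (fun x => (dist_triangle _ (G₁ x) _).trans (by linarith [hd x, hd' x]))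
    (fun x => (dist_triangle _ (G₁.symm x) _).trans (by linarith [hds x, hds' x]))
    (hlv'.trans (ENNReal.ofReal_le_ofReal (by rw [hVar]; linarith)))
  have hnκ : 1 / (n : ℝ) = 4 * κ := by rw [hκ]; field_simp
  have hinv : 1 / (n : ℝ≥0∞) = ENNReal.ofReal (4 * κ) := by
    rw [← hnκ, ENNReal.ofReal_div_of_pos hn0, ENNReal.ofReal_one, ENNReal.ofReal_natCast]
  have hn1 : 4 * κ ≤ 1 := by
    rw [← hnκ, div_le_one hn0]
    exact_mod_cast hn
  have hlt : 1 - 1 / (n : ℝ≥0∞) < volume (g '' O) := by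
    refine lt_of_lt_of_le ?_ hgO
    rw [hinv, ← ENNReal.ofReal_one, ← ENNReal.ofReal_sub _ (by positivity)]
    exact (ENNReal.ofReal_lt_ofReal_iff (by linarith)).2 (by linarith)
  obtain ⟨E, hEO, hE, hgE⟩ := exists_finUnionTriangles_image g hO hOQ hg hlt
  refine ⟨(g, g.symm), ⟨hgX, E, hEO.trans hOQ, hE, ?_, hgE⟩, hdist⟩
  refine ((measure_mono hEO).trans hvO).trans_lt ?_
  rw [hinv]
  exact (ENNReal.ofReal_lt_ofReal_iff (by positivity)).2 (by linarith)

end
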